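/- (Poisson formula.) Let F_0, ..., F_n ∈ ℂ[x_0,...,x_n] be homogeneous of degrees d_0, ..., d_n. Set f_i(x_0,...,x_{n-1}) := F_i(x_0,...,x_{n-1},1) and F̄_i(x_0,...,x_{n-1}) := F_i(x_0,...,x_{n-1},0) for all i. If Res(F̄_0, ..., F̄_{n-1}) ≠ 0, then the quotient ring A = ℂ[x_0,...,x_{n-1}]/(f_0,...,f_{n-1}) has dimension d_0 ⋯ d_{n-1} as a vector space over ℂ, and Res(F_0, ..., F_n) = Res(F̄_0, ..., F̄_{n-1})^{d_n} · det(m_{f_n} : A → A), where m_{f_n} : A → A is the ℂ-linear map given by multiplication by f_n. -/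

import Mathlib

open MvPolynomial

/-- `Mono m e` is the type of exponent vectors of total degree `e` in `m` variables. -/
abbrev Mono (m e : ℕ) : Type := {α : Fin m → ℕ // ∑ j, α j = e}

instance (m e : ℕ) : Fintype (Mono m e) :=
  Fintype.subtype (Finset.Nat.antidiagonalTuple m e) fun _ => Finset.Nat.mem_antidiagonalTuple

/-- The exponent vector as a finitely supported function (a monomial of `MvPolynomial`). -/
noncomputable abbrev Mono.toFinsupp {m e : ℕ} (α : Mono m e) : Fin m →₀ ℕ :=
  Finsupp.equivFunOnFinite.symm α.1

/-- The index type for the variables `u_{i,α}` of the universal ring of coefficients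
`ℤ[u_{i,α} : i, |α| = d i]` for `m` forms of degrees `d 0, …, d (m-1)` in `m` variables. -/
abbrev CoeffIdx (m : ℕ) (d : Fin m → ℕ) : Type := Σ i : Fin m, Mono m (d i)

/-- Evaluation `P ↦ P(F_0, …, F_{m-1})` : each universal variable `u_{i,α}` is replaced by the
corresponding coefficient `c_{i,α}` of `F_i`. -/
noncomputable def resEval {m : ℕ} (d : Fin m → ℕ) (F : Fin m → MvPolynomial (Fin m) ℂ)
    (R : MvPolynomial (CoeffIdx m d) ℤ) : ℂ :=
  eval₂ (Int.castRingHom ℂ) (fun v => coeff v.2.toFinsupp (F v.1)) R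

/-- `IsResultant m d R` says that `R` is *the* resultant polynomial `Res_{d_0,…,d_n}` (`m = n+1`):
(1) for homogeneous `F_i` of degrees `d i`, the system `F_0 = ⋯ = F_n = 0` has a nontrivial
solution over `ℂ` iff `R(F_0,…,F_n) = 0`; (2) `R` is irreducible, even over `ℂ`;
(3) `R(x_0^{d_0},…,x_n^{d_n}) = 1`. -/
def IsResultant (m : ℕ) (d : Fin m → ℕ) (R : MvPolynomial (CoeffIdx m d) ℤ) : Prop :=
  (∀ F : Fin m → MvPolynomial (Fin m) ℂ, (∀ i, (F i).IsHomogeneous (d i)) →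
    ((∃ x : Fin m → ℂ, x ≠ 0 ∧ ∀ i, eval x (F i) = 0) ↔ resEval d F R = 0)) ∧
  Irreducible R ∧ Irreducible (MvPolynomial.map (Int.castRingHom ℂ) R) ∧
  resEval d (fun i => X i ^ d i) R = 1

/-- Every syzygy of the family `f` is a combination of the Koszul syzygies. -/
def KoszulExact {R : Type*} [CommRing R] {m : ℕ} (f : Fin m → R) : Prop :=
  ∀ q : Fin m → R, ∑ i, q i * f i = 0 →
    ∃ b : Fin m → Fin m → R, ∀ i, q i = ∑ j, (b i j - b j i) * f j

lemma sum_koszul_eq_zero {R : Type*} [CommRing R] {m : ℕ} (f : Fin m → R)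
    (b : Fin m → Fin m → R) : ∑ i, (∑ j, (b i j - b j i) * f j) * f i = 0 := by
  simp_rw [Finset.sum_mul, sub_mul, Finset.sum_sub_distrib]
  rw [sub_eq_zero]
  conv_rhs => rw [Finset.sum_comm]
  exact Finset.sum_congr rfl fun i _ => Finset.sum_congr rfl fun j _ => by ring

lemma mem_span_range_iff_exists_sum {R : Type*} [CommRing R] {m : ℕ} (f : Fin m → R) (p : R) :
    p ∈ Ideal.span (Set.range f) ↔ ∃ q : Fin m → R, ∑ i, q i * f i = p :=
  Ideal.mem_span_range_iff_exists_fun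

section Hyperplane

variable {R R' : Type*} [CommRing R] [CommRing R'] {m : ℕ}

lemma exists_lift_syzygy (π : R →+* R') (hπ : Function.Surjective π) (l : R)
    (hker : ∀ p, π p = 0 → ∃ q, p = l * q) (f : Fin m → R)
    (hf : KoszulExact fun i => π (f i)) (q : Fin m → R) (hq : π (∑ i, q i * f i) = 0) :
    ∃ (b : Fin m → Fin m → R) (r : Fin m → R),
      ∀ i, q i = ∑ j, (b i j - b j i) * f j + l * r i := by
  obtain ⟨b', hb'⟩ := hf (fun i => π (q i)) (by simpa using hq)
  choose s hs using hπ
  have : ∀ i, ∃ r, q i - ∑ j, (s (b' i j) - s (b' j i)) * f j = l * r := fun i =>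
    hker _ (by simp [hs, hb' i])
  choose r hr using this
  exact ⟨fun i j => s (b' i j), r, fun i => by rw [← hr i]; ring⟩

lemma mem_span_of_mul_mem_span (π : R →+* R') (hπ : Function.Surjective π) (l : R)
    (hker : ∀ p, π p = 0 → ∃ q, p = l * q) (hl : π l = 0) (hreg : IsLeftRegular l)
    (f : Fin m → R) (hf : KoszulExact fun i => π (f i)) (g : R)
    (hg : l * g ∈ Ideal.span (Set.range f)) : g ∈ Ideal.span (Set.range f) := by
  rw [mem_span_range_iff_exists_sum] at hg ⊢
  obtain ⟨q, hq⟩ := hg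
  obtain ⟨b, r, hr⟩ := exists_lift_syzygy π hπ l hker f hf q (by rw [hq]; simp [hl])
  refine ⟨r, hreg ?_⟩
  simp only
  rw [← hq]
  simp_rw [hr, add_mul, Finset.sum_add_distrib, sum_koszul_eq_zero, zero_add, Finset.mul_sum,
    mul_assoc]

lemma KoszulExact.of_castSucc (F : Fin (m + 1) → R) (h : KoszulExact fun i : Fin m => F i.castSucc)
    (hreg : ∀ p, p * F (Fin.last m) ∈ Ideal.span (Set.range fun i : Fin m => F i.castSucc) →
      p ∈ Ideal.span (Set.range fun i : Fin m => F i.castSucc)) : KoszulExact F := by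
  intro q hq
  rw [Fin.sum_univ_castSucc] at hq
  have h1 : q (Fin.last m) ∈ Ideal.span (Set.range fun i : Fin m => F i.castSucc) := by
    apply hreg
    rw [mem_span_range_iff_exists_sum]
    exact ⟨fun i => - q i.castSucc, by simp [← eq_neg_of_add_eq_zero_right hq]⟩
  rw [mem_span_range_iff_exists_sum] at h1
  obtain ⟨a, ha⟩ := h1
  obtain ⟨b, hb⟩ := h (fun i => q i.castSucc + a i * F (Fin.last m)) (by
    simp_rw [add_mul, Finset.sum_add_distrib]
    rw [← hq, ← ha, Finset.sum_mul]
    congr 1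
    exact Finset.sum_congr rfl fun i _ => by ring)
  refine ⟨fun i j => Fin.lastCases (Fin.lastCases 0 (fun j => a j) j)
    (fun i => Fin.lastCases 0 (fun j => b i j) j) i, fun i => ?_⟩
  induction i using Fin.lastCases with
  | last => simp [Fin.sum_univ_castSucc, ha]
  | cast i =>
    simp only [Fin.sum_univ_castSucc, Fin.lastCases_castSucc, Fin.lastCases_last]
    rw [← hb i]; ring

end Hyperplane

section Graded

variable {σ k : Type*} [CommRing k]

/-- The component of degree `e : ℤ` of a polynomial. -/
noncomputable def intComponent (e : ℤ) : MvPolynomial σ k →ₗ[k] MvPolynomial σ k :=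
  weightedHomogeneousComponent (fun _ => (1 : ℤ)) e

lemma coeff_intComponent (e : ℤ) (p : MvPolynomial σ k) (a : σ →₀ ℕ) :
    coeff a (intComponent e p) = if (a.degree : ℤ) = e then coeff a p else 0 := by
  classical
  rw [intComponent, coeff_weightedHomogeneousComponent]
  have : Finsupp.weight (fun _ => (1 : ℤ)) a = (a.degree : ℤ) := by
    rw [Finsupp.degree_apply, Nat.cast_sum, Finsupp.weight_apply, Finsupp.sum]
    simp
  rw [this]

lemma intComponent_intComponent (e : ℤ) (p : MvPolynomial σ k) :
    intComponent e (intComponent e p) = intComponent e p := by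
  ext a
  simp only [coeff_intComponent]
  split_ifs <;> rfl

lemma intComponent_of_neg {e : ℤ} (he : e < 0) (p : MvPolynomial σ k) : intComponent e p = 0 := by
  ext a
  rw [coeff_intComponent, if_neg (by lia), coeff_zero]

lemma intComponent_mul {d : ℕ} {F : MvPolynomial σ k} (hF : F.IsHomogeneous d) (e : ℤ)
    (p : MvPolynomial σ k) : intComponent e (p * F) = intComponent (e - d) p * F := by
  classical
  ext a
  have h (x : (σ →₀ ℕ) × (σ →₀ ℕ)) (hx : x ∈ Finset.HasAntidiagonal.antidiagonal a) :
      coeff x.1 (intComponent (e - d) p) * coeff x.2 F =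
        if (a.degree : ℤ) = e then coeff x.1 p * coeff x.2 F else 0 := by
    by_cases h2 : x.2.degree = d
    · rw [← Finset.HasAntidiagonal.mem_antidiagonal.1 hx, coeff_intComponent, map_add, h2,
        ite_mul, zero_mul]
      congr 1
      simp only [Nat.cast_add, eq_iff_iff]
      lia
    · simp [hF.coeff_eq_zero h2]
  rw [coeff_intComponent, coeff_mul, coeff_mul, Finset.sum_congr rfl h]
  split_ifs <;> simp

lemma intComponent_eq_self {d : ℕ} {F : MvPolynomial σ k} (hF : F.IsHomogeneous d) :
    intComponent d F = F := by
  ext a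
  rw [coeff_intComponent]
  split_ifs with h
  · rfl
  · exact (hF.coeff_eq_zero (by exact_mod_cast h)).symm

lemma isHomogeneous_intComponent (d : ℕ) (p : MvPolynomial σ k) :
    (intComponent (d : ℤ) p).IsHomogeneous d := by
  intro a ha
  rw [coeff_intComponent] at ha
  have : (a.degree : ℤ) = d := by
    by_contra h
    simp [h] at ha
  rw [show (1 : σ → ℕ) = fun _ => 1 from rfl, ← Finsupp.degree_eq_weight_one]
  exact_mod_cast this

lemma sum_intComponent_sub (p : MvPolynomial σ k) {d N : ℕ} (hN : p.totalDegree + d < N) :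
    ∑ e ∈ Finset.range N, intComponent ((e : ℤ) - d) p = p := by
  ext a
  have h (e : ℕ) : ((a.degree : ℤ) = (e : ℤ) - d) = (a.degree + d = e) := by
    simp only [eq_iff_iff]; lia
  simp only [coeff_sum, coeff_intComponent, h, Finset.sum_ite_eq, Finset.mem_range]
  split_ifs with h
  · rfl
  · by_contra h0
    have := le_totalDegree (mem_support_iff.2 (Ne.symm h0))
    exact h (lt_of_le_of_lt (Nat.add_le_add_right this d) hN)

variable {R' : Type*} [CommRing R'] {m : ℕ}

lemma KoszulExact.of_graded_quotient_aux (π : MvPolynomial σ k →+* R')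
    (hπ : Function.Surjective π) (l : MvPolynomial σ k)
    (hker : ∀ p, π p = 0 → ∃ q, p = l * q) (hl : l.IsHomogeneous 1)
    (hreg : IsLeftRegular l) (d : Fin m → ℕ) (hd : ∀ i, 0 < d i)
    (F : Fin m → MvPolynomial σ k) (hF : ∀ i, (F i).IsHomogeneous (d i))
    (h : KoszulExact fun i => π (F i)) (e : ℕ) (q : Fin m → MvPolynomial σ k)
    (hqe : ∀ i, intComponent ((e : ℤ) - d i) (q i) = q i) (hq : ∑ i, q i * F i = 0) :
    ∃ b : Fin m → Fin m → MvPolynomial σ k, ∀ i, q i = ∑ j, (b i j - b j i) * F j := by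
  induction e generalizing q with
  | zero =>
    refine ⟨0, fun i => ?_⟩
    rw [← hqe, intComponent_of_neg (by have := hd i; lia)]
    simp
  | succ e ih =>
    obtain ⟨b, r, hr⟩ := exists_lift_syzygy π hπ l hker F h q (by rw [hq, map_zero])
    have key (i : Fin m) : q i = ∑ j, (intComponent ((e + 1 : ℤ) - d i - d j) (b i j) -
        intComponent ((e + 1 : ℤ) - d j - d i) (b j i)) * F j +
        l * intComponent ((e : ℤ) - d i) (r i) := by
      rw [← hqe i, hr i, map_add, map_sum, mul_comm l, intComponent_mul hl, mul_comm l]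
      congr 1
      · refine Finset.sum_congr rfl fun j _ => ?_
        rw [intComponent_mul (hF j), map_sub]
        push_cast
        rw [sub_right_comm (_ : ℤ) (d j : ℤ) (d i)]
      · congr 2
        push_cast; ring_nf
    obtain ⟨b', hb'⟩ := ih (fun i => intComponent ((e : ℤ) - d i) (r i))
        (fun i => intComponent_intComponent _ _) (by
      apply hreg
      simp only [mul_zero]
      rw [← hq]
      conv_rhs => rw [Finset.sum_congr rfl fun i _ => by rw [key i]]
      simp_rw [add_mul, Finset.sum_add_distrib]
      rw [sum_koszul_eq_zero F fun i j => intComponent ((e + 1 : ℤ) - d i - d j) (b i j),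
        zero_add, Finset.mul_sum]
      simp_rw [mul_assoc])
    refine ⟨fun i j => intComponent ((e + 1 : ℤ) - d i - d j) (b i j) + l * b' i j, fun i => ?_⟩
    conv_lhs => rw [key i, hb' i, Finset.mul_sum, ← Finset.sum_add_distrib]
    exact Finset.sum_congr rfl fun j _ => by ring

/-- Koszul exactness of forms lifts from the quotient by a regular linear form. -/
lemma KoszulExact.of_graded_quotient (π : MvPolynomial σ k →+* R')
    (hπ : Function.Surjective π) (l : MvPolynomial σ k)
    (hker : ∀ p, π p = 0 → ∃ q, p = l * q) (hl : l.IsHomogeneous 1)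
    (hreg : IsLeftRegular l) (d : Fin m → ℕ) (hd : ∀ i, 0 < d i)
    (F : Fin m → MvPolynomial σ k) (hF : ∀ i, (F i).IsHomogeneous (d i))
    (h : KoszulExact fun i => π (F i)) : KoszulExact F := by
  intro q hq
  have key (e : ℕ) := KoszulExact.of_graded_quotient_aux π hπ l hker hl hreg d hd F hF h e
    (fun i => intComponent ((e : ℤ) - d i) (q i)) (fun i => intComponent_intComponent _ _)
    (by simp_rw [← intComponent_mul (hF _), ← map_sum, hq, map_zero])
  choose b hb using key
  let N := ∑ i, ((q i).totalDegree + d i) + 1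
  refine ⟨fun i j => ∑ e ∈ Finset.range N, b e i j, fun i => ?_⟩
  rw [← sum_intComponent_sub (q i) (d := d i) (N := N) (Nat.lt_succ_of_le
    (Finset.single_le_sum (f := fun i => (q i).totalDegree + d i) (fun _ _ => Nat.zero_le _)
      (Finset.mem_univ i)))]
  simp_rw [hb _ i, ← Finset.sum_sub_distrib, Finset.sum_mul]
  exact Finset.sum_comm

end Graded

section Hilbert

variable {k S S' : Type*} [Field k] [CommRing S] [CommRing S'] [Algebra k S'] [Algebra k S]

/-- The dimension of the image of the subspace `V` in the quotient by `I`. -/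
noncomputable def quotientFinrank (I : Ideal S) (V : Submodule k S) : ℕ :=
  Module.finrank k (V.map (Ideal.Quotient.mkₐ k I).toLinearMap)

/-- Additivity of dimensions along `0 → S/I → S/I → S'/J → 0`, with first map multiplication
by `f`. -/
lemma quotientFinrank_eq_add (π : S →ₐ[k] S') (I : Ideal S) (J : Ideal S') (f : S)
    (U V : Submodule k S) (V' : Submodule k S') [Module.Finite k V]
    (hV : V.map π.toLinearMap = V') (hU : ∀ u ∈ U, f * u ∈ V) (hIJ : I ≤ J.comap π)
    (hf : π f ∈ J) (h1 : ∀ p ∈ V, π p ∈ J → ∃ u ∈ U, p - f * u ∈ I)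
    (h2 : ∀ u ∈ U, f * u ∈ I → u ∈ I) :
    quotientFinrank I V = quotientFinrank J V' + quotientFinrank I U := by
  set W := V.map (Ideal.Quotient.mkₐ k I).toLinearMap with hW
  let ψ : (S ⧸ I) →ₐ[k] (S' ⧸ J) := Ideal.quotientMapₐ J π hIJ
  have hψ (p : S) : ψ (Ideal.Quotient.mk I p) = Ideal.Quotient.mk J (π p) := rfl
  have hfin : Module.Finite k W := inferInstance
  have hadd := LinearMap.finrank_range_add_finrank_ker (ψ.toLinearMap.domRestrict W)
  have hrange : LinearMap.range (ψ.toLinearMap.domRestrict W) =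
      V'.map (Ideal.Quotient.mkₐ k J).toLinearMap := by
    rw [LinearMap.range_domRestrict, hW, ← hV, ← Submodule.map_comp, ← Submodule.map_comp]
    rfl
  let μ : (S ⧸ I) →ₗ[k] (S ⧸ I) := LinearMap.mulLeft k (Ideal.Quotient.mk I f)
  have hker : (LinearMap.ker (ψ.toLinearMap.domRestrict W)).map W.subtype =
      (U.map (Ideal.Quotient.mkₐ k I).toLinearMap).map μ := by
    ext x
    constructor
    · rintro ⟨⟨_, p, hp, rfl⟩, hx, rfl⟩
      have : Ideal.Quotient.mk J (π p) = 0 := hx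
      obtain ⟨u, hu, hpu⟩ := h1 p hp (Ideal.Quotient.eq_zero_iff_mem.1 this)
      refine ⟨_, ⟨u, hu, rfl⟩, ?_⟩
      have := Ideal.Quotient.eq.2 hpu
      simpa [μ] using this.symm
    · rintro ⟨_, ⟨u, hu, rfl⟩, rfl⟩
      refine ⟨⟨_, f * u, hU u hu, rfl⟩, ?_, by simp [μ]⟩
      change Ideal.Quotient.mk J (π (f * u)) = 0
      rw [Ideal.Quotient.eq_zero_iff_mem, map_mul]
      exact J.mul_mem_right _ hf
  have hkr : Module.finrank k (LinearMap.ker (ψ.toLinearMap.domRestrict W)) =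
      quotientFinrank I U := by
    rw [← Submodule.finrank_map_subtype_eq, hker, quotientFinrank, ← LinearMap.range_domRestrict]
    apply LinearMap.finrank_range_of_inj
    rw [← LinearMap.ker_eq_bot, LinearMap.ker_eq_bot']
    rintro ⟨_, u, hu, rfl⟩ h
    have h0 : Ideal.Quotient.mk I (f * u) = 0 := by simpa [μ] using h
    ext
    exact Ideal.Quotient.eq_zero_iff_mem.2 (h2 u hu (Ideal.Quotient.eq_zero_iff_mem.1 h0))
  rw [hrange, hkr] at hadd
  exact hadd.symm

end Hilbert

section Nullstellensatz

variable {σ ι : Type*}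

lemma exists_pow_mem_span_of_zeros [Finite σ] (F : ι → MvPolynomial σ ℂ)
    (h : ∀ x : σ → ℂ, (∀ i, eval x (F i) = 0) → x = 0) (l : MvPolynomial σ ℂ)
    (hl : eval 0 l = 0) : ∃ N : ℕ, l ^ N ∈ Ideal.span (Set.range F) := by
  have : l ∈ (Ideal.span (Set.range F)).radical := by
    rw [← vanishingIdeal_zeroLocus_eq_radical (K := ℂ), mem_vanishingIdeal_iff]
    intro x hx
    rw [h x fun i => hx _ (Ideal.subset_span ⟨i, rfl⟩)]
    exact hl
  exact this

lemma exists_degree_mem [Finite σ] (I : Ideal (MvPolynomial σ ℂ))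
    (h : ∀ j, ∃ N : ℕ, (X j : MvPolynomial σ ℂ) ^ N ∈ I) :
    ∃ D : ℕ, ∀ e, D ≤ e → ∀ p : MvPolynomial σ ℂ, p.IsHomogeneous e → p ∈ I := by
  classical
  have := Fintype.ofFinite σ
  choose N hN using h
  refine ⟨∑ j, N j + 1, fun e he p hp => ?_⟩
  rw [p.as_sum]
  refine I.sum_mem fun a ha => ?_
  have hdeg : a.degree = e := by
    by_contra h0
    exact mem_support_iff.1 ha (hp.coeff_eq_zero h0)
  have : ∃ j, N j ≤ a j := by
    by_contra! hlt
    have h1 : ∑ j, a j ≤ ∑ j, N j := Finset.sum_le_sum fun j _ => (hlt j).le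
    rw [Finsupp.degree_eq_sum] at hdeg
    lia
  obtain ⟨j, hj⟩ := this
  have hsplit : a = (a - Finsupp.single j (N j)) + Finsupp.single j (N j) :=
    (tsub_add_cancel_of_le (by simpa using hj)).symm
  rw [hsplit, ← mul_one (coeff _ p), ← monomial_mul, ← X_pow_eq_monomial]
  exact I.mul_mem_left _ (hN j)

variable {m : ℕ}

lemma exists_homogeneous_sum (d : Fin m → ℕ) (F : Fin m → MvPolynomial σ ℂ)
    (hF : ∀ i, (F i).IsHomogeneous (d i)) {e : ℕ} {p : MvPolynomial σ ℂ} (hp : p.IsHomogeneous e)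
    (h : p ∈ Ideal.span (Set.range F)) :
    ∃ q : Fin m → MvPolynomial σ ℂ, ∑ i, intComponent ((e : ℤ) - d i) (q i) * F i = p := by
  obtain ⟨q, hq⟩ := (mem_span_range_iff_exists_sum F p).1 h
  refine ⟨q, ?_⟩
  simp_rw [← intComponent_mul (hF _)]
  rw [← map_sum, hq, intComponent_eq_self hp]

lemma finite_affine_zeros [Finite σ] (d : Fin (m + 1) → ℕ) (hd : 0 < d (Fin.last m))
    (F : Fin (m + 1) → MvPolynomial σ ℂ) (hF : ∀ i, (F i).IsHomogeneous (d i))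
    (h : ∀ x : σ → ℂ, (∀ i, eval x (F i) = 0) → x = 0) :
    {x : σ → ℂ | (∀ i : Fin m, eval x (F i.castSucc) = 0) ∧
      eval x (F (Fin.last m)) = 1}.Finite := by
  obtain ⟨D, hD⟩ := exists_degree_mem (Ideal.span (Set.range F)) fun j =>
    exists_pow_mem_span_of_zeros F h (X j) (by simp)
  let I : Ideal (MvPolynomial σ ℂ) :=
    Ideal.span (Set.range (fun i : Fin m => F i.castSucc) ∪ {F (Fin.last m) - 1})
  let φ : MvPolynomial σ ℂ →ₐ[ℂ] MvPolynomial σ ℂ ⧸ I := Ideal.Quotient.mkₐ ℂ I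
  have hφ (i : Fin m) : φ (F i.castSucc) = 0 :=
    Ideal.Quotient.eq_zero_iff_mem.2 (Ideal.subset_span (Or.inl ⟨i, rfl⟩))
  have hφ1 : φ (F (Fin.last m)) = 1 := by
    have : φ (F (Fin.last m) - 1) = 0 :=
      Ideal.Quotient.eq_zero_iff_mem.2 (Ideal.subset_span (Or.inr rfl))
    rwa [map_sub, map_one, sub_eq_zero] at this
  let W : Submodule ℂ (MvPolynomial σ ℂ ⧸ I) :=
    ⨆ e ∈ Finset.range D, (homogeneousSubmodule σ ℂ e).map φ.toLinearMap
  have hWfg : W.FG := Submodule.fg_biSup _ _ fun e _ => (homogeneousSubmodule_fg σ ℂ e).map _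
  have hmem (e : ℕ) : ∀ p : MvPolynomial σ ℂ, p.IsHomogeneous e → φ p ∈ W := by
    induction e using Nat.strong_induction_on with
    | _ e ih =>
      intro p hp
      rcases lt_or_ge e D with he | he
      · exact Submodule.mem_iSup_of_mem e (Submodule.mem_iSup_of_mem (Finset.mem_range.2 he)
          ⟨p, hp, rfl⟩)
      · obtain ⟨q, hq⟩ := exists_homogeneous_sum d F hF hp (hD e he p hp)
        rw [← hq, Fin.sum_univ_castSucc, map_add, map_sum]
        simp only [map_mul, hφ, hφ1, mul_zero, Finset.sum_const_zero, zero_add, mul_one]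
        rcases lt_or_ge e (d (Fin.last m)) with hlt | hge
        · rw [intComponent_of_neg (by lia), map_zero]
          exact W.zero_mem
        · rw [← Nat.cast_sub hge]
          exact ih _ (by lia) _ (isHomogeneous_intComponent _ _)
  have hW : W = ⊤ := by
    rw [eq_top_iff]
    rintro x -
    obtain ⟨p, rfl⟩ := Ideal.Quotient.mkₐ_surjective ℂ I x
    rw [← sum_intComponent_sub p (d := 0) (Nat.lt_succ_self _), map_sum]
    refine W.sum_mem fun e _ => hmem e _ ?_
    simpa using isHomogeneous_intComponent e p
  have hfin : Module.Finite ℂ (MvPolynomial σ ℂ ⧸ I) := ⟨hW ▸ hWfg⟩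
  let P (j : σ) : Polynomial ℂ := minpoly ℂ (φ (X j))
  have hP (j : σ) : P j ≠ 0 := minpoly.ne_zero (Algebra.IsIntegral.isIntegral _)
  refine (Set.Finite.pi' fun j => ((P j).rootSet_finite ℂ)).subset ?_
  rintro x ⟨hx0, hx1⟩ j
  have hI : ∀ p ∈ I, aeval x p = 0 := by
    intro p hp
    have : I ≤ RingHom.ker (aeval x : MvPolynomial σ ℂ →ₐ[ℂ] ℂ) := by
      rw [Ideal.span_le]
      rintro _ (⟨i, rfl⟩ | rfl)
      · exact hx0 i
      · simpa [sub_eq_zero] using hx1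
    exact this hp
  let ev : (MvPolynomial σ ℂ ⧸ I) →ₐ[ℂ] ℂ := Ideal.Quotient.liftₐ I (aeval x) hI
  have hev : ev (φ (X j)) = x j := by
    change aeval x (X j : MvPolynomial σ ℂ) = x j
    simp
  rw [Polynomial.mem_rootSet]
  refine ⟨hP j, ?_⟩
  rw [← hev, Polynomial.aeval_algHom_apply, minpoly.aeval, map_zero]

lemma exists_linear_form_ne_zero [Fintype σ] (T : Set (σ → ℂ)) (hT : T.Finite)
    (h0 : ∀ x ∈ T, x ≠ 0) : ∃ c : σ → ℂ, ∀ x ∈ T, ∑ i, c i * x i ≠ 0 := by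
  classical
  let P : MvPolynomial σ ℂ := ∏ x ∈ hT.toFinset, ∑ i, C (x i) * X i
  have hP : P ≠ 0 := by
    refine Finset.prod_ne_zero_iff.2 fun x hx h => ?_
    obtain ⟨j, hj⟩ := Function.ne_iff.1 (h0 x (by simpa using hx))
    apply hj
    have := congrArg (eval (Pi.single j 1)) h
    simpa [Pi.single_apply] using this
  by_contra! hc
  refine hP (MvPolynomial.funext fun c => ?_)
  obtain ⟨x, hx, hcx⟩ := hc c
  rw [map_zero, map_prod]
  refine Finset.prod_eq_zero (hT.mem_toFinset.2 hx) ?_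
  simpa [mul_comm] using hcx

end Nullstellensatz

lemma eval_smul_of_isHomogeneous {σ R : Type*} [CommRing R] {p : MvPolynomial σ R} {d : ℕ}
    (hp : p.IsHomogeneous d) (t : R) (x : σ → R) : eval (t • x) p = t ^ d * eval x p := by
  rw [eval_eq, eval_eq, Finset.mul_sum]
  refine Finset.sum_congr rfl fun a ha => ?_
  have hdeg : a.degree = d := by
    by_contra h0
    exact mem_support_iff.1 ha (hp.coeff_eq_zero h0)
  simp only [Pi.smul_apply, smul_eq_mul, mul_pow, Finset.prod_mul_distrib]
  rw [Finset.prod_pow_eq_pow_sum, ← Finsupp.degree_apply, hdeg]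
  ring

section Hyperplane

variable {n : ℕ}

/-- The linear form `x_n - ∑ c_i x_i`. -/
noncomputable def hyperplaneForm (c : Fin n → ℂ) : MvPolynomial (Fin (n + 1)) ℂ :=
  X (Fin.last n) - ∑ i, C (c i) * X i.castSucc

/-- Restriction of polynomials to the hyperplane `x_n = ∑ c_i x_i`. -/
noncomputable def hyperplaneRestrict (c : Fin n → ℂ) :
    MvPolynomial (Fin (n + 1)) ℂ →ₐ[ℂ] MvPolynomial (Fin n) ℂ :=
  aeval (Fin.snoc (fun j => X j) (∑ i, C (c i) * X i : MvPolynomial (Fin n) ℂ))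

lemma isHomogeneous_hyperplaneForm (c : Fin n → ℂ) : (hyperplaneForm c).IsHomogeneous 1 := by
  refine (isHomogeneous_X _ _).sub (IsHomogeneous.sum _ _ _ fun i _ => ?_)
  simpa using (isHomogeneous_C (Fin (n + 1)) (c i)).mul (isHomogeneous_X ℂ i.castSucc)

lemma hyperplaneForm_ne_zero (c : Fin n → ℂ) : hyperplaneForm c ≠ 0 := by
  intro h
  have := congrArg (eval (Pi.single (Fin.last n) 1)) h
  simp [hyperplaneForm, Fin.castSucc_ne_last] at this

lemma hyperplaneRestrict_rename (c : Fin n → ℂ) (p : MvPolynomial (Fin n) ℂ) :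
    hyperplaneRestrict c (rename Fin.castSucc p) = p := by
  rw [hyperplaneRestrict, aeval_rename]
  have : (Fin.snoc (fun j => X j) (∑ i, C (c i) * X i : MvPolynomial (Fin n) ℂ) :
      Fin (n + 1) → MvPolynomial (Fin n) ℂ) ∘ Fin.castSucc = X := by
    ext1 i
    simp
  rw [this, aeval_X_left_apply]

lemma hyperplaneRestrict_surjective (c : Fin n → ℂ) :
    Function.Surjective (hyperplaneRestrict c) := fun p => ⟨_, hyperplaneRestrict_rename c p⟩

lemma hyperplaneRestrict_form (c : Fin n → ℂ) :
    hyperplaneRestrict c (hyperplaneForm c) = 0 := by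
  simp [hyperplaneRestrict, hyperplaneForm]

lemma exists_eq_hyperplaneForm_mul (c : Fin n → ℂ) (p : MvPolynomial (Fin (n + 1)) ℂ)
    (hp : hyperplaneRestrict c p = 0) : ∃ q, p = hyperplaneForm c * q := by
  let I := Ideal.span {hyperplaneForm c}
  have h : ((Ideal.Quotient.mkₐ ℂ I).comp (rename Fin.castSucc)).comp (hyperplaneRestrict c) =
      Ideal.Quotient.mkₐ ℂ I := by
    refine algHom_ext fun i => ?_
    induction i using Fin.lastCases with
    | cast i => simp [hyperplaneRestrict]
    | last =>
      have : Ideal.Quotient.mk I (hyperplaneForm c) = 0 :=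
        Ideal.Quotient.eq_zero_iff_mem.2 (Ideal.subset_span rfl)
      rw [hyperplaneForm, map_sub, sub_eq_zero] at this
      simpa [hyperplaneRestrict] using this.symm
  have h0 : Ideal.Quotient.mk I p = 0 := by
    have := DFunLike.congr_fun h p
    simpa [hp] using this.symm
  obtain ⟨q, hq⟩ := Ideal.mem_span_singleton'.1 (Ideal.Quotient.eq_zero_iff_mem.1 h0)
  exact ⟨q, by rw [← hq, mul_comm]⟩

lemma eval_hyperplaneRestrict (c x : Fin n → ℂ) (p : MvPolynomial (Fin (n + 1)) ℂ) :
    eval x (hyperplaneRestrict c p) =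
      eval (Fin.snoc x (∑ i, c i * x i) : Fin (n + 1) → ℂ) p := by
  have : ((aeval x : MvPolynomial (Fin n) ℂ →ₐ[ℂ] ℂ).comp (hyperplaneRestrict c)) =
      aeval (Fin.snoc x (∑ i, c i * x i) : Fin (n + 1) → ℂ) := by
    refine algHom_ext fun i => ?_
    induction i using Fin.lastCases <;> simp [hyperplaneRestrict]
  exact DFunLike.congr_fun this p

lemma isHomogeneous_hyperplaneRestrict (c : Fin n → ℂ) {p : MvPolynomial (Fin (n + 1)) ℂ}
    {e : ℕ} (hp : p.IsHomogeneous e) : (hyperplaneRestrict c p).IsHomogeneous e := by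
  rw [← one_mul e]
  refine hp.aeval _ fun i => ?_
  induction i using Fin.lastCases with
  | cast i => simpa using isHomogeneous_X ℂ i
  | last =>
    simp only [Fin.snoc_last]
    refine IsHomogeneous.sum _ _ _ fun i _ => ?_
    simpa using (isHomogeneous_C (Fin n) (c i)).mul (isHomogeneous_X ℂ i)

lemma map_hyperplaneRestrict (c : Fin n → ℂ) (e : ℕ) :
    (homogeneousSubmodule (Fin (n + 1)) ℂ e).map (hyperplaneRestrict c).toLinearMap =
      homogeneousSubmodule (Fin n) ℂ e := by
  ext p
  constructor
  · rintro ⟨q, hq, rfl⟩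
    exact isHomogeneous_hyperplaneRestrict c hq
  · intro hp
    exact ⟨rename Fin.castSucc p, IsHomogeneous.rename_isHomogeneous hp,
      hyperplaneRestrict_rename c p⟩

/-- A hyperplane avoiding the common zeros of all but the last of the given forms. -/
lemma exists_hyperplane (d : Fin (n + 1) → ℕ) (hd : ∀ i, 0 < d i)
    (F : Fin (n + 1) → MvPolynomial (Fin (n + 1)) ℂ) (hF : ∀ i, (F i).IsHomogeneous (d i))
    (h : ∀ x, (∀ i, eval x (F i) = 0) → x = 0) :
    ∃ c : Fin n → ℂ, ∀ x, (∀ i : Fin n, eval x (F i.castSucc) = 0) →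
      eval x (hyperplaneForm c) = 0 → x = 0 := by
  have hfin := finite_affine_zeros d (hd _) F hF h
  set T := {x : Fin (n + 1) → ℂ | (∀ i : Fin n, eval x (F i.castSucc) = 0) ∧
      eval x (F (Fin.last n)) = 1}
  obtain ⟨b, hb⟩ := exists_linear_form_ne_zero (insert (Pi.single (Fin.last n) 1) T)
    (hfin.insert _) (by
      rintro x (rfl | hx) h0
      · simpa using congrFun h0 (Fin.last n)
      · have h1 := hx.2
        rw [h0, ← zero_smul ℂ (0 : Fin (n + 1) → ℂ), eval_smul_of_isHomogeneous (hF _),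
          zero_pow (hd _).ne', zero_mul] at h1
        exact zero_ne_one h1)
  have hlast : b (Fin.last n) ≠ 0 := by
    have := hb _ (Set.mem_insert _ _)
    simpa [Pi.single_apply] using this
  refine ⟨fun i => -(b i.castSucc / b (Fin.last n)), fun x hx hlx => ?_⟩
  have hbx : ∑ i, b i * x i = 0 := by
    rw [hyperplaneForm] at hlx
    have h2 : x (Fin.last n) + ∑ i : Fin n, b i.castSucc / b (Fin.last n) * x i.castSucc = 0 := by
      simpa [Finset.sum_neg_distrib] using hlx
    rw [Fin.sum_univ_castSucc, ← mul_zero (b (Fin.last n)), ← h2, mul_add, Finset.mul_sum,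
      add_comm]
    congr 1
    exact Finset.sum_congr rfl fun i _ => by field_simp
  by_contra hx0
  have hne : eval x (F (Fin.last n)) ≠ 0 := fun h0 => hx0 (h x fun i => by
    induction i using Fin.lastCases with
    | last => exact h0
    | cast i => exact hx i)
  obtain ⟨t, ht⟩ := IsAlgClosed.exists_pow_nat_eq (eval x (F (Fin.last n)))⁻¹ (hd (Fin.last n))
  refine hb (t • x) (Or.inr ⟨fun i => ?_, ?_⟩) ?_
  · rw [eval_smul_of_isHomogeneous (hF _), hx, mul_zero]
  · rw [eval_smul_of_isHomogeneous (hF _), ht, inv_mul_cancel₀ hne]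
  · simp_rw [Pi.smul_apply, smul_eq_mul, mul_left_comm _ t]
    rw [← Finset.mul_sum, hbx, mul_zero]

end Hyperplane

section CompleteIntersection

lemma mem_of_pow_mul_mem {S : Type*} [CommRing S] {I : Ideal S} {l : S}
    (h : ∀ g, l * g ∈ I → g ∈ I) (N : ℕ) {g : S} (hg : l ^ N * g ∈ I) : g ∈ I := by
  induction N with
  | zero => simpa using hg
  | succ N ih => exact ih (h _ (by rwa [← mul_assoc, ← pow_succ']))

lemma mem_span_of_mul_last_mem {S : Type*} [CommRing S] {m : ℕ} (F : Fin (m + 1) → S) (l : S)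
    (h : ∀ g, l * g ∈ Ideal.span (Set.range fun i : Fin m => F i.castSucc) →
      g ∈ Ideal.span (Set.range fun i : Fin m => F i.castSucc))
    {N : ℕ} (hN : l ^ N ∈ Ideal.span (Set.range F)) (g : S)
    (hg : g * F (Fin.last m) ∈ Ideal.span (Set.range fun i : Fin m => F i.castSucc)) :
    g ∈ Ideal.span (Set.range fun i : Fin m => F i.castSucc) := by
  obtain ⟨q, hq⟩ := (mem_span_range_iff_exists_sum F _).1 hN
  refine mem_of_pow_mul_mem h N ?_
  rw [← hq, Finset.sum_mul, Fin.sum_univ_castSucc]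
  refine Ideal.add_mem _ (Ideal.sum_mem _ fun i _ => ?_) ?_
  · exact Ideal.mul_mem_right _ _ (Ideal.mul_mem_left _ _ (Ideal.subset_span ⟨i, rfl⟩))
  · rw [mul_assoc, mul_comm (F _)]
    exact Ideal.mul_mem_left _ _ hg

instance finite_homogeneousSubmodule (σ : Type*) [Finite σ] (e : ℕ) :
    Module.Finite ℂ (homogeneousSubmodule σ ℂ e) :=
  Module.Finite.iff_fg.2 (homogeneousSubmodule_fg σ ℂ e)

variable {n : ℕ}

/-- The Hilbert function of a homogeneous ideal, given as the dimension of a graded piece. -/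
noncomputable def hilbertFn {σ : Type*} (I : Ideal (MvPolynomial σ ℂ)) (e : ℕ) : ℕ :=
  quotientFinrank I (homogeneousSubmodule σ ℂ e)

lemma span_range_castSucc_le {S : Type*} [CommRing S] {m : ℕ} (F : Fin (m + 1) → S) :
    Ideal.span (Set.range fun i : Fin m => F i.castSucc) ≤ Ideal.span (Set.range F) :=
  Ideal.span_mono (by rintro _ ⟨i, rfl⟩; exact ⟨_, rfl⟩)

lemma map_span_range {S S' ι : Type*} [CommRing S] [CommRing S'] (π : S →+* S') (F : ι → S) :
    (Ideal.span (Set.range F)).map π = Ideal.span (Set.range fun i => π (F i)) := by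
  rw [Ideal.map_span, ← Set.range_comp]
  rfl

/-- If `π p` lies in the ideal generated by the `π (F i)`, then a form `p` is congruent to a
multiple of the equation of the hyperplane modulo the `F i`. -/
lemma exists_sub_mul_mem_span {m : ℕ} (c : Fin n → ℂ) (F : Fin m → MvPolynomial (Fin (n + 1)) ℂ)
    (p : MvPolynomial (Fin (n + 1)) ℂ)
    (h : hyperplaneRestrict c p ∈ Ideal.span (Set.range fun i => hyperplaneRestrict c (F i))) :
    ∃ q, p - hyperplaneForm c * q ∈ Ideal.span (Set.range F) := by
  obtain ⟨q, hq⟩ := (mem_span_range_iff_exists_sum _ _).1 h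
  choose s hs using fun i => hyperplaneRestrict_surjective c (q i)
  obtain ⟨u, hu⟩ := exists_eq_hyperplaneForm_mul c (p - ∑ i, s i * F i) (by simp [hs, hq])
  refine ⟨u, (mem_span_range_iff_exists_sum _ _).2 ⟨s, ?_⟩⟩
  rw [← hu]
  ring

lemma intComponent_mem_span {σ : Type*} {m : ℕ} (d : Fin m → ℕ) (F : Fin m → MvPolynomial σ ℂ)
    (hF : ∀ i, (F i).IsHomogeneous (d i)) {p : MvPolynomial σ ℂ}
    (h : p ∈ Ideal.span (Set.range F)) (e : ℤ) :
    intComponent e p ∈ Ideal.span (Set.range F) := by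
  obtain ⟨q, rfl⟩ := (mem_span_range_iff_exists_sum _ _).1 h
  rw [map_sum]
  refine Ideal.sum_mem _ fun i _ => ?_
  rw [intComponent_mul (hF i)]
  exact Ideal.mul_mem_left _ _ (Ideal.subset_span ⟨i, rfl⟩)

/-- Hilbert functions of forms `F i` and of their restrictions to a hyperplane which is a
nonzerodivisor. -/
lemma hilbertFn_succ {m : ℕ} (c : Fin n → ℂ) (d : Fin m → ℕ)
    (F : Fin m → MvPolynomial (Fin (n + 1)) ℂ) (hF : ∀ i, (F i).IsHomogeneous (d i))
    (h : ∀ g, hyperplaneForm c * g ∈ Ideal.span (Set.range F) → g ∈ Ideal.span (Set.range F))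
    (e : ℕ) :
    hilbertFn (Ideal.span (Set.range F)) (e + 1) =
      hilbertFn (Ideal.span (Set.range fun i => hyperplaneRestrict c (F i))) (e + 1) +
        hilbertFn (Ideal.span (Set.range F)) e := by
  refine quotientFinrank_eq_add (hyperplaneRestrict c) _ _ (hyperplaneForm c) _ _ _
    (map_hyperplaneRestrict c _) ?_ ?_ ?_ ?_ fun u _ => h u
  · intro u hu
    rw [mem_homogeneousSubmodule, mul_comm]
    exact IsHomogeneous.mul hu (isHomogeneous_hyperplaneForm c)
  · rw [← Ideal.map_le_iff_le_comap]
    exact (map_span_range (hyperplaneRestrict c).toRingHom F).le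
  · rw [hyperplaneRestrict_form]
    exact Ideal.zero_mem _
  · intro p hp hπ
    obtain ⟨q, hq⟩ := exists_sub_mul_mem_span c F p hπ
    refine ⟨intComponent (e : ℤ) q, isHomogeneous_intComponent e q, ?_⟩
    have := intComponent_mem_span d F hF hq ((e + 1 : ℕ) : ℤ)
    rw [map_sub, intComponent_eq_self hp, mul_comm,
      intComponent_mul (isHomogeneous_hyperplaneForm c)] at this
    rw [mul_comm]
    simpa using this

lemma hilbertFn_zero {m : ℕ} (c : Fin n → ℂ) (d : Fin m → ℕ)
    (F : Fin m → MvPolynomial (Fin (n + 1)) ℂ) (hF : ∀ i, (F i).IsHomogeneous (d i)) :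
    hilbertFn (Ideal.span (Set.range F)) 0 =
      hilbertFn (Ideal.span (Set.range fun i => hyperplaneRestrict c (F i))) 0 := by
  have := quotientFinrank_eq_add (hyperplaneRestrict c) (Ideal.span (Set.range F))
    (Ideal.span (Set.range fun i => hyperplaneRestrict c (F i))) (hyperplaneForm c) ⊥ _ _
    (map_hyperplaneRestrict c 0) (by simp) ?_ ?_ ?_ (by simp)
  · have h0 : quotientFinrank (Ideal.span (Set.range F)) (⊥ : Submodule ℂ _) = 0 := by
      simp [quotientFinrank]
    rw [h0, add_zero] at this
    exact this
  · rw [← Ideal.map_le_iff_le_comap]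
    exact (map_span_range (hyperplaneRestrict c).toRingHom F).le
  · rw [hyperplaneRestrict_form]
    exact Ideal.zero_mem _
  · intro p hp hπ
    obtain ⟨q, hq⟩ := exists_sub_mul_mem_span c F p hπ
    refine ⟨0, Submodule.zero_mem _, ?_⟩
    have := intComponent_mem_span d F hF hq 0
    have h1 := intComponent_eq_self hp
    rw [Nat.cast_zero] at h1
    rw [map_sub, h1, mul_comm, intComponent_mul (isHomogeneous_hyperplaneForm c),
      intComponent_of_neg (by simp)] at this
    simpa using this

/-- The Hilbert function is the sum of the Hilbert function of the hyperplane section. -/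
lemma hilbertFn_eq_sum {m : ℕ} (c : Fin n → ℂ) (d : Fin m → ℕ)
    (F : Fin m → MvPolynomial (Fin (n + 1)) ℂ) (hF : ∀ i, (F i).IsHomogeneous (d i))
    (h : ∀ g, hyperplaneForm c * g ∈ Ideal.span (Set.range F) → g ∈ Ideal.span (Set.range F))
    (e : ℕ) :
    hilbertFn (Ideal.span (Set.range F)) e =
      ∑ j ∈ Finset.range (e + 1),
        hilbertFn (Ideal.span (Set.range fun i => hyperplaneRestrict c (F i))) j := by
  induction e with
  | zero => simp [hilbertFn_zero c d F hF]
  | succ e ih => rw [hilbertFn_succ c d F hF h, ih, Finset.sum_range_succ _ (e + 1), add_comm]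

lemma exists_sub_mul_last_mem_span {S : Type*} [CommRing S] {m : ℕ} (F : Fin (m + 1) → S) (p : S)
    (h : p ∈ Ideal.span (Set.range F)) :
    ∃ q, p - F (Fin.last m) * q ∈ Ideal.span (Set.range fun i : Fin m => F i.castSucc) := by
  obtain ⟨q, hq⟩ := (mem_span_range_iff_exists_sum _ _).1 h
  refine ⟨q (Fin.last m), (mem_span_range_iff_exists_sum _ _).2 ⟨fun i => q i.castSucc, ?_⟩⟩
  rw [← hq, Fin.sum_univ_castSucc]
  ring

lemma hilbertFn_add_last {σ : Type*} [Finite σ] {m : ℕ} (d : Fin (m + 1) → ℕ)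
    (F : Fin (m + 1) → MvPolynomial σ ℂ) (hF : ∀ i, (F i).IsHomogeneous (d i))
    (h : ∀ g, F (Fin.last m) * g ∈ Ideal.span (Set.range fun i : Fin m => F i.castSucc) →
      g ∈ Ideal.span (Set.range fun i : Fin m => F i.castSucc)) (e : ℕ) :
    hilbertFn (Ideal.span (Set.range fun i : Fin m => F i.castSucc)) (e + d (Fin.last m)) =
      hilbertFn (Ideal.span (Set.range F)) (e + d (Fin.last m)) +
        hilbertFn (Ideal.span (Set.range fun i : Fin m => F i.castSucc)) e := by
  refine quotientFinrank_eq_add (AlgHom.id ℂ _) _ _ (F (Fin.last m)) _ _ _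
    (by ext; simp) ?_ ?_ ?_ ?_ fun u _ => h u
  · intro u hu
    rw [mem_homogeneousSubmodule, mul_comm]
    exact IsHomogeneous.mul hu (hF _)
  · exact span_range_castSucc_le F
  · exact Ideal.subset_span ⟨_, rfl⟩
  · intro p hp hπ
    obtain ⟨q, hq⟩ := exists_sub_mul_last_mem_span F p hπ
    refine ⟨intComponent (e : ℤ) q, isHomogeneous_intComponent e q, ?_⟩
    have := intComponent_mem_span _ _ (fun i : Fin m => hF i.castSucc) hq
      ((e + d (Fin.last m) : ℕ) : ℤ)
    rw [map_sub, intComponent_eq_self hp, mul_comm, intComponent_mul (hF _)] at this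
    rw [mul_comm]
    simpa using this

lemma hilbertFn_of_lt_last {σ : Type*} [Finite σ] {m : ℕ} (d : Fin (m + 1) → ℕ)
    (F : Fin (m + 1) → MvPolynomial σ ℂ) (hF : ∀ i, (F i).IsHomogeneous (d i)) {e : ℕ}
    (he : e < d (Fin.last m)) :
    hilbertFn (Ideal.span (Set.range fun i : Fin m => F i.castSucc)) e =
      hilbertFn (Ideal.span (Set.range F)) e := by
  have := quotientFinrank_eq_add (AlgHom.id ℂ _)
    (Ideal.span (Set.range fun i : Fin m => F i.castSucc)) (Ideal.span (Set.range F))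
    (F (Fin.last m)) ⊥ (homogeneousSubmodule σ ℂ e) (homogeneousSubmodule σ ℂ e)
    (by ext; simp)
    (fun u hu => by rw [(Submodule.mem_bot ℂ).1 hu, mul_zero]; exact Submodule.zero_mem _)
    (span_range_castSucc_le F) (Ideal.subset_span ⟨_, rfl⟩) ?_ (by simp)
  · have h0 : quotientFinrank (Ideal.span (Set.range fun i : Fin m => F i.castSucc))
      (⊥ : Submodule ℂ _) = 0 := by simp [quotientFinrank]
    rw [h0, add_zero] at this
    exact this
  · intro p hp hπ
    obtain ⟨q, hq⟩ := exists_sub_mul_last_mem_span F p hπ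
    refine ⟨0, Submodule.zero_mem _, ?_⟩
    have := intComponent_mem_span _ _ (fun i : Fin m => hF i.castSucc) hq (e : ℤ)
    rw [map_sub, intComponent_eq_self hp, mul_comm, intComponent_mul (hF _),
      intComponent_of_neg (by lia)] at this
    simpa using this

end CompleteIntersection

section CompleteIntersection

lemma sum_range_eq_of_shift (h g : ℕ → ℕ) (d D E : ℕ)
    (h1 : ∀ e, g (e + d) = h (e + d) + g e) (h2 : ∀ e < d, g e = h e)
    (hE : ∀ e, E ≤ e → g e = D) (M : ℕ) (hM : E ≤ M) :
    ∑ j ∈ Finset.range (M + d), h j = D * d := by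
  have key : ∀ M, ∑ j ∈ Finset.range (M + d), h j + ∑ j ∈ Finset.range M, g j =
      ∑ j ∈ Finset.range (M + d), g j := by
    intro M
    induction M with
    | zero =>
      simp only [zero_add, Finset.range_zero, Finset.sum_empty, add_zero]
      exact Finset.sum_congr rfl fun j hj => (h2 j (Finset.mem_range.1 hj)).symm
    | succ M ih =>
      rw [add_right_comm, Finset.sum_range_succ, Finset.sum_range_succ _ M,
        Finset.sum_range_succ _ (M + d), ← ih, h1]
      ring
  have h3 := key M
  rw [Finset.sum_range_add g, Finset.sum_congr rfl fun j _ => hE (M + j) (by lia), add_comm] at h3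
  simpa [mul_comm] using h3

/-- Forms without common zeros on a hyperplane at infinity form a regular sequence, and they have
the expected Hilbert polynomial. -/
theorem koszulExact_and_hilbertFn (n : ℕ) (d : Fin n → ℕ) (hd : ∀ i, 0 < d i)
    (F : Fin n → MvPolynomial (Fin (n + 1)) ℂ) (hF : ∀ i, (F i).IsHomogeneous (d i))
    (c : Fin n → ℂ)
    (h : ∀ x, (∀ i, eval x (F i) = 0) → eval x (hyperplaneForm c) = 0 → x = 0) :
    KoszulExact F ∧
    (∀ g, hyperplaneForm c * g ∈ Ideal.span (Set.range F) → g ∈ Ideal.span (Set.range F)) ∧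
    ∃ E, ∀ e, E ≤ e → hilbertFn (Ideal.span (Set.range F)) e = ∏ i, d i := by
  induction n with
  | zero =>
    have hI : Ideal.span (Set.range F) = ⊥ := by
      rw [Set.range_eq_empty, Ideal.span_empty]
    refine ⟨fun q _ => ⟨0, fun i => i.elim0⟩, fun g hg => ?_, 0, fun e _ => ?_⟩
    · rw [hI, Ideal.mem_bot] at hg ⊢
      exact (mul_eq_zero.1 hg).resolve_left (hyperplaneForm_ne_zero c)
    · have hspan : homogeneousSubmodule (Fin (0 + 1)) ℂ e = Submodule.span ℂ {X 0 ^ e} := by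
        refine le_antisymm (fun p hp => Submodule.mem_span_singleton.2
          ⟨coeff (Finsupp.single 0 e) p, ?_⟩) ?_
        · ext a
          obtain ⟨k, rfl⟩ : ∃ k, a = Finsupp.single 0 k :=
            ⟨a 0, by ext i; simp [Fin.fin_one_eq_zero i]⟩
          rw [coeff_smul, coeff_X_pow]
          by_cases hk : e = k
          · simp [hk]
          · have := IsHomogeneous.coeff_eq_zero hp (d := Finsupp.single 0 k)
              (by simpa using Ne.symm hk)
            simp [this, hk]
        · rw [Submodule.span_singleton_le_iff_mem]
          exact isHomogeneous_X_pow _ _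
      rw [hilbertFn, quotientFinrank, hspan, Submodule.map_span, Set.image_singleton,
        finrank_span_singleton]
      · simp
      · intro h0
        have h1 := Ideal.Quotient.eq_zero_iff_mem.1 h0
        rw [hI, Ideal.mem_bot] at h1
        exact pow_ne_zero _ (X_ne_zero _) h1
  | succ n ih =>
    set G : Fin (n + 1) → MvPolynomial (Fin (n + 1)) ℂ := fun i => hyperplaneRestrict c (F i)
      with hG
    have hGhom (i) : (G i).IsHomogeneous (d i) := isHomogeneous_hyperplaneRestrict c (hF i)
    have hG0 (x) (hx : ∀ i, eval x (G i) = 0) : x = 0 := by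
      simp only [hG, eval_hyperplaneRestrict] at hx
      have h0 := h _ hx (by rw [hyperplaneForm]; simp)
      ext i
      simpa using congrFun h0 i.castSucc
    obtain ⟨c', hc'⟩ := exists_hyperplane d hd G hGhom hG0
    obtain ⟨hK, hreg, E, hE⟩ := ih (fun i => d i.castSucc) (fun i => hd _)
      (fun i => G i.castSucc) (fun i => hGhom _) c' hc'
    obtain ⟨N, hN⟩ := exists_pow_mem_span_of_zeros G hG0 (hyperplaneForm c')
      (by simp [hyperplaneForm])
    have hlast := mem_span_of_mul_last_mem G _ hreg hN
    have hKG : KoszulExact G := hK.of_castSucc G hlast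
    have hl : IsLeftRegular (hyperplaneForm c) :=
      (IsRegular.of_ne_zero (hyperplaneForm_ne_zero c)).left
    have hKF : KoszulExact F := KoszulExact.of_graded_quotient (hyperplaneRestrict c).toRingHom
      (hyperplaneRestrict_surjective c) _ (exists_eq_hyperplaneForm_mul c)
      (isHomogeneous_hyperplaneForm c) hl d hd F hF hKG
    have hnzd (g) := mem_span_of_mul_mem_span (hyperplaneRestrict c).toRingHom
      (hyperplaneRestrict_surjective c) _ (exists_eq_hyperplaneForm_mul c)
      (hyperplaneRestrict_form c) hl F hKG g
    refine ⟨hKF, hnzd, E + d (Fin.last n), fun e he => ?_⟩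
    rw [hilbertFn_eq_sum c d F hF hnzd]
    have := sum_range_eq_of_shift (hilbertFn (Ideal.span (Set.range G)))
      (hilbertFn (Ideal.span (Set.range fun i : Fin n => G i.castSucc))) (d (Fin.last n)) _ E
      (hilbertFn_add_last d G hGhom fun g hg => hlast g (by rwa [mul_comm]))
      (fun _ => hilbertFn_of_lt_last d G hGhom) hE (e + 1 - d (Fin.last n)) (by lia)
    rw [Nat.sub_add_cancel (by lia)] at this
    rw [Fin.prod_univ_castSucc]
    exact this

end CompleteIntersection

section Determinant

variable {k V W : Type*} [Field k] [AddCommGroup V] [AddCommGroup W] [Module k V] [Module k W]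
  [Module.Finite k V] [Module.Finite k W]

lemma det_id_add_comp_comm (f : V →ₗ[k] W) (g : W →ₗ[k] V) :
    LinearMap.det (LinearMap.id + g ∘ₗ f) = LinearMap.det (LinearMap.id + f ∘ₗ g) := by
  let b := Module.finBasis k V
  let b' := Module.finBasis k W
  rw [← LinearMap.det_toMatrix b, ← LinearMap.det_toMatrix b', map_add, map_add,
    LinearMap.toMatrix_comp b b' b, LinearMap.toMatrix_comp b' b b', LinearMap.toMatrix_id,
    LinearMap.toMatrix_id, Matrix.det_one_add_mul_comm]

/-- The determinant of the endomorphism replacing the section `s` of `r` by `t`. -/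
lemma det_eq_det_of_section (r : V →ₗ[k] W) (s t : W →ₗ[k] V) (hs : r ∘ₗ s = LinearMap.id) :
    LinearMap.det (LinearMap.id + (t - s) ∘ₗ r) = LinearMap.det (r ∘ₗ t) := by
  rw [det_id_add_comp_comm, LinearMap.comp_sub, hs, add_sub_cancel]

lemma det_scale_section (r : V →ₗ[k] W) (s : W →ₗ[k] V) (hs : r ∘ₗ s = LinearMap.id) (x : k) :
    LinearMap.det (LinearMap.id + (x • s - s) ∘ₗ r) = x ^ Module.finrank k W := by
  rw [det_eq_det_of_section r s (x • s) hs, LinearMap.comp_smul, hs, LinearMap.det_smul,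
    LinearMap.det_id, mul_one]

end Determinant

section Dehomogenization

variable {n : ℕ}

/-- Setting the last variable equal to `1`. -/
noncomputable def dehomogenize (n : ℕ) :
    MvPolynomial (Fin (n + 1)) ℂ →ₐ[ℂ] MvPolynomial (Fin n) ℂ :=
  aeval (Fin.snoc (fun j => X j) (1 : MvPolynomial (Fin n) ℂ))

lemma dehomogenize_X_last : dehomogenize n (X (Fin.last n)) = 1 := by
  simp [dehomogenize]

lemma dehomogenize_rename (p : MvPolynomial (Fin n) ℂ) :
    dehomogenize n (rename Fin.castSucc p) = p := by
  rw [dehomogenize, aeval_rename]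
  have : (Fin.snoc (fun j => X j) (1 : MvPolynomial (Fin n) ℂ) :
      Fin (n + 1) → MvPolynomial (Fin n) ℂ) ∘ Fin.castSucc = X := by
    ext1 i
    simp
  rw [this, aeval_X_left_apply]

lemma eval_dehomogenize (x : Fin n → ℂ) (p : MvPolynomial (Fin (n + 1)) ℂ) :
    eval x (dehomogenize n p) = eval (Fin.snoc x 1 : Fin (n + 1) → ℂ) p := by
  have : ((aeval x : MvPolynomial (Fin n) ℂ →ₐ[ℂ] ℂ).comp (dehomogenize n)) =
      aeval (Fin.snoc x 1 : Fin (n + 1) → ℂ) := by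
    refine algHom_ext fun i => ?_
    induction i using Fin.lastCases <;> simp [dehomogenize]
  exact DFunLike.congr_fun this p

lemma eq_zero_of_dehomogenize_eq_zero {p : MvPolynomial (Fin (n + 1)) ℂ} {e : ℕ}
    (hp : p.IsHomogeneous e) (h : dehomogenize n p = 0) : p = 0 := by
  have h0 : X (Fin.last n) * p = 0 := by
    refine MvPolynomial.funext fun x => ?_
    rw [map_mul, eval_X, map_zero, mul_eq_zero, or_iff_not_imp_left]
    intro hx
    have hsm : x = x (Fin.last n) •
        (Fin.snoc (fun i : Fin n => x i.castSucc / x (Fin.last n)) 1 : Fin (n + 1) → ℂ) := by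
      ext i
      induction i using Fin.lastCases with
      | last => simp
      | cast i => simp [mul_div_cancel₀ _ hx]
    rw [hsm, eval_smul_of_isHomogeneous hp, ← eval_dehomogenize, h, map_zero, mul_zero]
  exact (mul_eq_zero.1 h0).resolve_left (X_ne_zero _)

/-- Every polynomial of degree at most `D` is the dehomogenization of a form of degree `D`. -/
lemma exists_dehomogenize_eq (q : MvPolynomial (Fin n) ℂ) {D : ℕ} (hD : q.totalDegree ≤ D) :
    ∃ p : MvPolynomial (Fin (n + 1)) ℂ, p.IsHomogeneous D ∧ dehomogenize n p = q := by
  refine ⟨∑ e ∈ Finset.range (q.totalDegree + 1), X (Fin.last n) ^ (D - e) *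
    rename Fin.castSucc (intComponent (e : ℤ) q), IsHomogeneous.sum _ _ _ fun e he => ?_, ?_⟩
  · have he' := Finset.mem_range.1 he
    have := (isHomogeneous_X_pow (R := ℂ) (Fin.last n) (D - e)).mul
      ((isHomogeneous_intComponent e q).rename_isHomogeneous (f := Fin.castSucc))
    rwa [Nat.sub_add_cancel (by lia)] at this
  · rw [map_sum]
    simp only [map_mul, map_pow, dehomogenize_X_last, one_pow, one_mul, dehomogenize_rename]
    simpa using sum_intComponent_sub q (d := 0) (Nat.lt_succ_self _)

lemma mem_span_of_dehomogenize_mem {m : ℕ} (d : Fin m → ℕ)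
    (G : Fin m → MvPolynomial (Fin (n + 1)) ℂ) (hG : ∀ i, (G i).IsHomogeneous (d i))
    (hreg : ∀ g, X (Fin.last n) * g ∈ Ideal.span (Set.range G) → g ∈ Ideal.span (Set.range G))
    {p : MvPolynomial (Fin (n + 1)) ℂ} {e : ℕ} (hp : p.IsHomogeneous e)
    (h : dehomogenize n p ∈ Ideal.span (Set.range fun i => dehomogenize n (G i))) :
    p ∈ Ideal.span (Set.range G) := by
  obtain ⟨q, hq⟩ := (mem_span_range_iff_exists_sum _ _).1 h
  let N := ∑ i, ((q i).totalDegree + d i)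
  have hN (i) : (q i).totalDegree + d i ≤ N := Finset.single_le_sum
    (f := fun i => (q i).totalDegree + d i) (fun _ _ => Nat.zero_le _) (Finset.mem_univ i)
  choose s hs1 hs2 using fun i => exists_dehomogenize_eq (q i) (D := e + N - d i)
    (by have := hN i; lia)
  have h1 : X (Fin.last n) ^ N * p = ∑ i, s i * G i := by
    rw [← sub_eq_zero]
    refine eq_zero_of_dehomogenize_eq_zero (e := e + N) (IsHomogeneous.sub ?_
      (IsHomogeneous.sum _ _ _ fun i _ => ?_)) ?_
    · rw [add_comm e]
      exact (isHomogeneous_X_pow _ _).mul hp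
    · have := (hs1 i).mul (hG i)
      rwa [Nat.sub_add_cancel (by have := hN i; lia)] at this
    · simp [dehomogenize_X_last, hs2, hq]
  refine mem_of_pow_mul_mem hreg N ?_
  rw [h1]
  exact (mem_span_range_iff_exists_sum _ _).2 ⟨s, rfl⟩

/-- The dimension of the quotient by the dehomogenizations of a complete intersection. -/
lemma dehomogenize_quotient_finite {m : ℕ} (d : Fin m → ℕ)
    (G : Fin m → MvPolynomial (Fin (n + 1)) ℂ) (hG : ∀ i, (G i).IsHomogeneous (d i))
    (hreg : ∀ g, X (Fin.last n) * g ∈ Ideal.span (Set.range G) → g ∈ Ideal.span (Set.range G))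
    (N E : ℕ) (hE : ∀ e, E ≤ e → hilbertFn (Ideal.span (Set.range G)) e = N) :
    Module.Finite ℂ (MvPolynomial (Fin n) ℂ ⧸
        Ideal.span (Set.range fun i => dehomogenize n (G i))) ∧
      Module.finrank ℂ (MvPolynomial (Fin n) ℂ ⧸
        Ideal.span (Set.range fun i => dehomogenize n (G i))) = N ∧
      ∀ e, E ≤ e → ∀ a : MvPolynomial (Fin n) ℂ ⧸
        Ideal.span (Set.range fun i => dehomogenize n (G i)),
        ∃ p : MvPolynomial (Fin (n + 1)) ℂ, p.IsHomogeneous e ∧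
          Ideal.Quotient.mk _ (dehomogenize n p) = a := by
  set J := Ideal.span (Set.range fun i => dehomogenize n (G i))
  set ρ : MvPolynomial (Fin (n + 1)) ℂ →ₗ[ℂ] MvPolynomial (Fin n) ℂ ⧸ J :=
    (Ideal.Quotient.mkₐ ℂ J).toLinearMap ∘ₗ (dehomogenize n).toLinearMap with hρ
  have hmem (p) : ρ p = 0 ↔ dehomogenize n p ∈ J := Ideal.Quotient.eq_zero_iff_mem
  set W := fun e => (homogeneousSubmodule (Fin (n + 1)) ℂ e).map ρ
  have hW (e) : Module.finrank ℂ (W e) = hilbertFn (Ideal.span (Set.range G)) e := by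
    have h1 := LinearMap.finrank_range_add_finrank_ker
      (ρ.domRestrict (homogeneousSubmodule (Fin (n + 1)) ℂ e))
    have h2 := LinearMap.finrank_range_add_finrank_ker
      ((Ideal.Quotient.mkₐ ℂ (Ideal.span (Set.range G))).toLinearMap.domRestrict
        (homogeneousSubmodule (Fin (n + 1)) ℂ e))
    have h3 : LinearMap.ker (ρ.domRestrict (homogeneousSubmodule (Fin (n + 1)) ℂ e)) =
        LinearMap.ker ((Ideal.Quotient.mkₐ ℂ (Ideal.span (Set.range G))).toLinearMap.domRestrict
          (homogeneousSubmodule (Fin (n + 1)) ℂ e)) := by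
      ext ⟨p, hp⟩
      simp only [LinearMap.mem_ker, LinearMap.domRestrict_apply]
      rw [hmem]
      change _ ↔ Ideal.Quotient.mk _ p = 0
      rw [Ideal.Quotient.eq_zero_iff_mem]
      refine ⟨mem_span_of_dehomogenize_mem d G hG hreg hp, fun h => ?_⟩
      exact (map_span_range (dehomogenize n).toRingHom G).le (Ideal.mem_map_of_mem _ h)
    rw [LinearMap.range_domRestrict] at h1 h2
    rw [h3] at h1
    exact Nat.add_right_cancel (h1.trans h2.symm)
  have hmono (e) : W e ≤ W (e + 1) := by
    rintro _ ⟨p, hp, rfl⟩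
    refine ⟨X (Fin.last n) * p, ?_, ?_⟩
    · have := (isHomogeneous_X ℂ (Fin.last n)).mul hp
      rwa [add_comm 1 e] at this
    · simp [hρ, dehomogenize_X_last]
  have hconst (e) (he : E ≤ e) : W e = W E := by
    induction e, he using Nat.le_induction with
    | base => rfl
    | succ e he ih =>
      rw [← ih]
      exact (Submodule.eq_of_le_of_finrank_eq (hmono e)
        (by rw [hW, hW, hE _ he, hE _ (by lia)])).symm
  have htop : W E = ⊤ := by
    rw [eq_top_iff]
    rintro a -
    obtain ⟨q, rfl⟩ := Ideal.Quotient.mkₐ_surjective ℂ J a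
    obtain ⟨p, hp, hpq⟩ := exists_dehomogenize_eq q (D := max E q.totalDegree) (le_max_right _ _)
    rw [← hconst (max E q.totalDegree) (le_max_left _ _)]
    exact ⟨p, hp, congrArg (Ideal.Quotient.mkₐ ℂ J) hpq⟩
  refine ⟨⟨?_⟩, ?_, fun e he a => ?_⟩
  · rw [← htop]
    exact (homogeneousSubmodule_fg _ _ _).map _
  · rw [← finrank_top, ← htop, hW, hE E le_rfl]
  · have ha : a ∈ W e := by rw [hconst e he, htop]; trivial
    obtain ⟨p, hp, rfl⟩ := ha
    exact ⟨p, hp, rfl⟩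

end Dehomogenization

section Coefficients

variable {m : ℕ} {d : Fin m → ℕ}

/-- The forms with prescribed coefficients. -/
noncomputable def coeffForm (c : CoeffIdx m d → ℂ) (i : Fin m) : MvPolynomial (Fin m) ℂ :=
  ∑ γ : Mono m (d i), monomial γ.toFinsupp (c ⟨i, γ⟩)

/-- The coefficients of a family of forms. -/
noncomputable def formCoeff (d : Fin m → ℕ) (F : Fin m → MvPolynomial (Fin m) ℂ)
    (v : CoeffIdx m d) : ℂ :=
  coeff v.2.toFinsupp (F v.1)

/-- Multiplication of the coefficients of the `i`-th form by `s`. -/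
def scaleCoeff {R : Type*} [Mul R] (i : Fin m) (s : R) (c : CoeffIdx m d → R)
    (v : CoeffIdx m d) : R :=
  if v.1 = i then s * c v else c v

lemma toFinsupp_injective {e : ℕ} : Function.Injective (Mono.toFinsupp : Mono m e → _) :=
  fun _ _ h => Subtype.ext (Finsupp.equivFunOnFinite.symm.injective h)

lemma degree_toFinsupp {e : ℕ} (γ : Mono m e) : γ.toFinsupp.degree = e := by
  rw [Finsupp.degree_eq_sum]
  exact γ.2

lemma exists_toFinsupp_eq {e : ℕ} (a : Fin m →₀ ℕ) (ha : a.degree = e) :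
    ∃ γ : Mono m e, γ.toFinsupp = a :=
  ⟨⟨a, by rw [← ha, Finsupp.degree_eq_sum]⟩, by ext; rfl⟩

lemma isHomogeneous_coeffForm (c : CoeffIdx m d → ℂ) (i : Fin m) :
    (coeffForm c i).IsHomogeneous (d i) :=
  IsHomogeneous.sum _ _ _ fun γ _ => isHomogeneous_monomial _ (degree_toFinsupp γ)

lemma formCoeff_coeffForm (c : CoeffIdx m d → ℂ) : formCoeff d (coeffForm c) = c := by
  classical
  ext ⟨i, γ⟩
  simp only [formCoeff, coeffForm, coeff_sum, coeff_monomial]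
  rw [Finset.sum_eq_single γ] <;> simp +contextual [toFinsupp_injective.eq_iff]

lemma coeffForm_formCoeff {F : Fin m → MvPolynomial (Fin m) ℂ}
    (hF : ∀ i, (F i).IsHomogeneous (d i)) : coeffForm (formCoeff d F) = F := by
  classical
  ext i a
  simp only [formCoeff, coeffForm, coeff_sum, coeff_monomial]
  by_cases ha : a.degree = d i
  · obtain ⟨γ, rfl⟩ := exists_toFinsupp_eq a ha
    rw [Finset.sum_eq_single γ] <;> simp +contextual [toFinsupp_injective.eq_iff]
  · rw [(hF i).coeff_eq_zero ha]
    refine Finset.sum_eq_zero fun γ _ => if_neg ?_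
    rintro rfl
    exact ha (degree_toFinsupp γ)

lemma coeffForm_scaleCoeff (i : Fin m) (s : ℂ) (c : CoeffIdx m d → ℂ) (j : Fin m) :
    coeffForm (scaleCoeff i s c) j = if j = i then s • coeffForm c j else coeffForm c j := by
  simp only [coeffForm, scaleCoeff]
  split_ifs with h
  · simp [Finset.smul_sum, smul_monomial]
  · rfl

lemma resEval_eq_eval (F : Fin m → MvPolynomial (Fin m) ℂ) (R : MvPolynomial (CoeffIdx m d) ℤ) :
    resEval d F R = eval (formCoeff d F) (map (Int.castRingHom ℂ) R) := by
  rw [eval_map]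
  rfl

end Coefficients

section Macaulay

lemma exists_eval_eq_det {ι k V : Type*} [Fintype ι] [Field k] [AddCommGroup V] [Module k V]
    [Module.Finite k V] (L : ι → V →ₗ[k] V) :
    ∃ M : MvPolynomial ι k, ∀ c : ι → k, eval c M = LinearMap.det (∑ w, c w • L w) := by
  classical
  let b := Module.finBasis k V
  refine ⟨(∑ w, (X w : MvPolynomial ι k) • (LinearMap.toMatrix b b (L w)).map C).det, fun c => ?_⟩
  rw [RingHom.map_det, ← LinearMap.det_toMatrix b]
  congr 1
  ext i j
  simp [Matrix.sum_apply]

lemma sum_formCoeff_smul {m : ℕ} {d : Fin m → ℕ} {V : Type*} [AddCommGroup V] [Module ℂ V]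
    (a : Fin m → V →ₗ[ℂ] MvPolynomial (Fin m) ℂ) (c : CoeffIdx m d → ℂ) (v : V) :
    ∑ w, c w • (a w.1 v * monomial w.2.toFinsupp 1) = ∑ i, a i v * coeffForm c i := by
  rw [Fintype.sum_sigma]
  refine Finset.sum_congr rfl fun i _ => ?_
  rw [coeffForm, Finset.mul_sum]
  refine Finset.sum_congr rfl fun γ _ => ?_
  rw [← mul_smul_comm, smul_monomial, smul_eq_mul, mul_one]

lemma exists_linear_homogeneous_sum {σ V : Type*} [AddCommGroup V] [Module ℂ V] {m : ℕ}
    (d : Fin m → ℕ) (G : Fin m → MvPolynomial σ ℂ) (hG : ∀ i, (G i).IsHomogeneous (d i)) {D : ℕ}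
    (P : V →ₗ[ℂ] MvPolynomial σ ℂ) (hP : ∀ v, (P v).IsHomogeneous D)
    (hPG : ∀ v, P v ∈ Ideal.span (Set.range G)) :
    ∃ U : V →ₗ[ℂ] Fin m → MvPolynomial σ ℂ,
      (∀ v, ∑ i, intComponent ((D : ℤ) - d i) (U v i) * G i = P v) ∧
      ∀ v, P v = 0 → U v = 0 := by
  let T : (Fin m → MvPolynomial σ ℂ) →ₗ[ℂ] MvPolynomial σ ℂ :=
    ∑ i, LinearMap.mulRight ℂ (G i) ∘ₗ intComponent ((D : ℤ) - d i) ∘ₗ LinearMap.proj i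
  have hT (q) : T q = ∑ i, intComponent ((D : ℤ) - d i) (q i) * G i := by
    simp [T]
  obtain ⟨u, hu⟩ := T.rangeRestrict.exists_rightInverse_of_surjective T.range_rangeRestrict
  have hPT (v) : P v ∈ LinearMap.range T := by
    obtain ⟨q, hq⟩ := exists_homogeneous_sum d G hG (hP v) (hPG v)
    exact ⟨q, (hT q).trans hq⟩
  refine ⟨u ∘ₗ P.codRestrict _ hPT, fun v => ?_, fun v hv => ?_⟩
  · rw [← hT]
    exact congrArg Subtype.val (LinearMap.congr_fun hu ⟨P v, hPT v⟩)
  · have : P.codRestrict _ hPT v = 0 := Subtype.ext hv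
    rw [LinearMap.comp_apply, this, map_zero]

lemma exists_macaulay_det {m D : ℕ} (d : Fin m → ℕ)
    (a : Fin m → homogeneousSubmodule (Fin m) ℂ D →ₗ[ℂ] MvPolynomial (Fin m) ℂ)
    (ha : ∀ i v p, p.IsHomogeneous (d i) → (a i v * p).IsHomogeneous D) :
    ∃ (M : MvPolynomial (CoeffIdx m d) ℂ)
      (Φ : (CoeffIdx m d → ℂ) → Module.End ℂ (homogeneousSubmodule (Fin m) ℂ D)),
      (∀ c, eval c M = LinearMap.det (Φ c)) ∧
      (∀ c v, (Φ c v : MvPolynomial (Fin m) ℂ) = ∑ i, a i v * coeffForm c i) ∧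
      ∀ c, (∃ x, x ≠ 0 ∧ ∀ i, eval x (coeffForm c i) = 0) → eval c M = 0 := by
  have hmono (w : CoeffIdx m d) : (monomial w.2.toFinsupp (1 : ℂ)).IsHomogeneous (d w.1) :=
    isHomogeneous_monomial _ (degree_toFinsupp _)
  let L (w : CoeffIdx m d) : Module.End ℂ (homogeneousSubmodule (Fin m) ℂ D) :=
    (LinearMap.mulRight ℂ (monomial w.2.toFinsupp 1) ∘ₗ a w.1).codRestrict _
      fun v => ha _ _ _ (hmono w)
  have hΦ (c : CoeffIdx m d → ℂ) (v) : ((∑ w, c w • L w) v : MvPolynomial (Fin m) ℂ) =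
      ∑ i, a i v * coeffForm c i := by
    rw [← sum_formCoeff_smul]
    simp only [LinearMap.sum_apply, LinearMap.smul_apply, Submodule.coe_sum, Submodule.coe_smul]
    rfl
  obtain ⟨M, hM⟩ := exists_eval_eq_det L
  refine ⟨M, fun c => ∑ w, c w • L w, hM, hΦ, fun c ⟨x, hx, hc⟩ => ?_⟩
  rw [hM]
  by_contra hne
  obtain ⟨j, hj⟩ := Function.ne_iff.1 hx
  have hsur := ((Module.End.isUnit_iff _).1
    ((LinearMap.isUnit_iff_isUnit_det (∑ w, c w • L w)).2 (Ne.isUnit hne))).2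
  obtain ⟨v, hv⟩ := hsur ⟨X j ^ D, isHomogeneous_X_pow _ _⟩
  have h1 := (hΦ c v).symm.trans (congrArg Subtype.val hv)
  have h2 := congrArg (eval x) h1
  simp only [map_sum, map_mul, hc, mul_zero, Finset.sum_const_zero, map_pow, eval_X] at h2
  exact pow_ne_zero _ hj h2.symm

/-- A polynomial in the coefficients which vanishes on the forms with a common zero, and which is
the determinant of multiplication by the last form when the others are fixed. -/
theorem exists_macaulay {n : ℕ} (d : Fin (n + 1) → ℕ) (hd : ∀ i, 0 < d i)
    (G : Fin n → MvPolynomial (Fin (n + 1)) ℂ) (hG : ∀ i, (G i).IsHomogeneous (d i.castSucc))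
    (h : ∀ x, (∀ i, eval x (G i) = 0) → x (Fin.last n) = 0 → x = 0) :
    Module.finrank ℂ (MvPolynomial (Fin n) ℂ ⧸
        Ideal.span (Set.range fun i => dehomogenize n (G i))) = ∏ i : Fin n, d i.castSucc ∧
      ∃ M : MvPolynomial (CoeffIdx (n + 1) d) ℂ,
        (∀ c, (∃ x, x ≠ 0 ∧ ∀ i, eval x (coeffForm c i) = 0) → eval c M = 0) ∧
        (∀ s c, eval (scaleCoeff (Fin.last n) s c) M =
          s ^ (∏ i : Fin n, d i.castSucc) * eval c M) ∧
        ∀ F : Fin (n + 1) → MvPolynomial (Fin (n + 1)) ℂ, (∀ i, (F i).IsHomogeneous (d i)) →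
          (∀ i : Fin n, F i.castSucc = G i) →
          eval (formCoeff d F) M = LinearMap.det (LinearMap.mulLeft ℂ (Ideal.Quotient.mk
            (Ideal.span (Set.range fun i => dehomogenize n (G i)))
            (dehomogenize n (F (Fin.last n))))) := by
  obtain ⟨-, hreg, E, hE⟩ := koszulExact_and_hilbertFn n (fun i => d i.castSucc) (fun i => hd _)
    G hG 0 (fun x hx hl => h x hx (by simpa [hyperplaneForm] using hl))
  replace hreg : ∀ g, X (Fin.last n) * g ∈ Ideal.span (Set.range G) →
      g ∈ Ideal.span (Set.range G) := by simpa [hyperplaneForm] using hreg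
  obtain ⟨hfin, hrank, hsurj⟩ := dehomogenize_quotient_finite _ G hG hreg _ E hE
  refine ⟨hrank, ?_⟩
  have hker {p : MvPolynomial (Fin (n + 1)) ℂ} {e : ℕ} (hp : p.IsHomogeneous e)
      (h0 : Ideal.Quotient.mk (Ideal.span (Set.range fun i => dehomogenize n (G i)))
        (dehomogenize n p) = 0) : p ∈ Ideal.span (Set.range G) :=
    mem_span_of_dehomogenize_mem _ G hG hreg hp (Ideal.Quotient.eq_zero_iff_mem.1 h0)
  clear hreg hE h
  generalize Ideal.span (Set.range fun i => dehomogenize n (G i)) = J at *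
  obtain ⟨ρ, hρ0⟩ : ∃ ρ : MvPolynomial (Fin (n + 1)) ℂ →ₗ[ℂ] MvPolynomial (Fin n) ℂ ⧸ J,
      ∀ p, ρ p = Ideal.Quotient.mk J (dehomogenize n p) :=
    ⟨(Ideal.Quotient.mkₐ ℂ J).toLinearMap ∘ₗ (dehomogenize n).toLinearMap, fun _ => rfl⟩
  have hρ (p q) : ρ (p * q) = ρ p * Ideal.Quotient.mk J (dehomogenize n q) := by simp [hρ0]
  obtain ⟨σ, hσE, hσ⟩ : ∃ σ : (MvPolynomial (Fin n) ℂ ⧸ J) →ₗ[ℂ] MvPolynomial (Fin (n + 1)) ℂ,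
      (∀ a, (σ a).IsHomogeneous E) ∧ ∀ a, ρ (σ a) = a := by
    obtain ⟨σ, hσ⟩ := (ρ ∘ₗ (homogeneousSubmodule (Fin (n + 1)) ℂ
      E).subtype).exists_rightInverse_of_surjective (LinearMap.range_eq_top.2 fun a => by
        obtain ⟨p, hp, hpa⟩ := hsurj E le_rfl a
        exact ⟨⟨p, hp⟩, (hρ0 p).trans hpa⟩)
    exact ⟨Submodule.subtype _ ∘ₗ σ, fun a => (σ a).2, fun a => LinearMap.congr_fun hσ a⟩
  have hmul (p : MvPolynomial (Fin (n + 1)) ℂ) (hp : p.IsHomogeneous (d (Fin.last n))) :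
      ∃ t : (MvPolynomial (Fin n) ℂ ⧸ J) →ₗ[ℂ]
        homogeneousSubmodule (Fin (n + 1)) ℂ (E + d (Fin.last n)), ∀ a, (t a).1 = σ a * p :=
    ⟨(LinearMap.mulRight ℂ p ∘ₗ σ).codRestrict _ fun a => (hσE a).mul hp, fun a => rfl⟩
  obtain ⟨s, hs⟩ := hmul _ (isHomogeneous_X_pow (Fin.last n) _)
  let r := ρ ∘ₗ (homogeneousSubmodule (Fin (n + 1)) ℂ (E + d (Fin.last n))).subtype
  have hr (v) : r v = ρ v.1 := rfl
  clear_value r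
  have hrs (a) : r (s a) = a := by simp [hr, hs, hρ, hσ, dehomogenize_X_last]
  have hPr (v) : r (v - s (r v)) = 0 := by rw [map_sub, hrs, sub_self]
  obtain ⟨P, hP⟩ : ∃ P : homogeneousSubmodule (Fin (n + 1)) ℂ (E + d (Fin.last n)) →ₗ[ℂ]
      MvPolynomial (Fin (n + 1)) ℂ, ∀ v, P v = (v - s (r v)).1 :=
    ⟨Submodule.subtype _ ∘ₗ (LinearMap.id - s ∘ₗ r), fun _ => rfl⟩
  have hPE (v) : (P v).IsHomogeneous (E + d (Fin.last n)) := hP v ▸ (v - s (r v)).2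
  obtain ⟨U, hU, hU0⟩ := exists_linear_homogeneous_sum (fun i : Fin n => d i.castSucc) G hG
    P hPE (fun v => hker (hPE v) (by rw [← hρ0, hP, ← hr, hPr]))
  have hUs (v) : U (s (r v)) = 0 := hU0 _ (by simp [hP, hrs])
  let a : Fin (n + 1) → homogeneousSubmodule (Fin (n + 1)) ℂ (E + d (Fin.last n)) →ₗ[ℂ]
      MvPolynomial (Fin (n + 1)) ℂ := Fin.snoc (fun i => intComponent
        (((E + d (Fin.last n) : ℕ) : ℤ) - d (Fin.castSucc i)) ∘ₗ LinearMap.proj i ∘ₗ U) (σ ∘ₗ r)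
  have ha_last (v) : a (Fin.last n) v = σ (r v) := by simp [a]
  have ha_cast (i : Fin n) (v) : a i.castSucc v =
      intComponent (((E + d (Fin.last n) : ℕ) : ℤ) - d (Fin.castSucc i)) (U v i) := by simp [a]
  clear_value a
  obtain ⟨M, Φ, hM, hΦ, hM0⟩ := exists_macaulay_det d a fun i v p hp => by
    induction i using Fin.lastCases with
    | last => rw [ha_last]; exact (hσE _).mul hp
    | cast i =>
      rw [ha_cast, ← intComponent_mul hp]
      exact isHomogeneous_intComponent _ _
  refine ⟨M, hM0, fun t c => ?_, fun F hF hFG => ?_⟩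
  · have : Φ (scaleCoeff (Fin.last n) t c) =
        Φ c ∘ₗ (LinearMap.id + (t • s - s) ∘ₗ r) := by
      ext1 v
      refine Subtype.ext ?_
      have h1 : (Φ c (s (r v))).1 = σ (r v) * coeffForm c (Fin.last n) := by
        rw [hΦ, Fin.sum_univ_castSucc]
        simp [ha_last, ha_cast, hrs, hUs]
      rw [LinearMap.comp_apply, LinearMap.add_apply, LinearMap.comp_apply, LinearMap.sub_apply,
        LinearMap.smul_apply, LinearMap.id_apply, map_add, map_sub, map_smul, Submodule.coe_add,
        Submodule.coe_sub, Submodule.coe_smul, h1, hΦ, hΦ, Fin.sum_univ_castSucc,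
        Fin.sum_univ_castSucc]
      simp only [coeffForm_scaleCoeff, Fin.castSucc_ne_last, if_true, if_false, ha_last,
        mul_smul_comm]
      abel
    rw [hM, hM, this, LinearMap.det_comp, det_scale_section r s (LinearMap.ext hrs), hrank,
      mul_comm]
  · obtain ⟨t, ht⟩ := hmul _ (hF (Fin.last n))
    have : Φ (formCoeff d F) = LinearMap.id + (t - s) ∘ₗ r := by
      ext1 v
      refine Subtype.ext ?_
      rw [hΦ, coeffForm_formCoeff hF, Fin.sum_univ_castSucc]
      simp only [ha_last, ha_cast, hFG]
      rw [hU]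
      simp only [hP, LinearMap.add_apply, LinearMap.id_apply, LinearMap.comp_apply,
        LinearMap.sub_apply, Submodule.coe_add, Submodule.coe_sub, ht]
      ring
    rw [hM, this, det_eq_det_of_section r s _ (LinearMap.ext hrs)]
    refine congrArg LinearMap.det (LinearMap.ext fun b => ?_)
    rw [LinearMap.comp_apply, hr, ht, hρ, hσ, mul_comm, LinearMap.mulLeft_apply]

end Macaulay

section ScalingDegree

lemma exists_eq_C_mul_X_pow_of_mul_eq {A : Type*} [CommRing A] [IsDomain A] {p q : Polynomial A}
    {m : A} (hm : m ≠ 0) {N : ℕ} (h : p * q = Polynomial.C m * Polynomial.X ^ N) :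
    ∃ a b, a + b = N ∧ (∃ u, p = Polynomial.C u * Polynomial.X ^ a) ∧
      ∃ v, q = Polynomial.C v * Polynomial.X ^ b := by
  have h0 : p * q ≠ 0 := by
    rw [h]
    exact mul_ne_zero (Polynomial.C_ne_zero.2 hm) (pow_ne_zero _ Polynomial.X_ne_zero)
  obtain ⟨hp, hq⟩ := mul_ne_zero_iff.1 h0
  have h1 : p.natDegree + q.natDegree = N := by
    rw [← Polynomial.natDegree_mul hp hq, h, Polynomial.natDegree_C_mul_X_pow _ _ hm]
  have h2 : p.natTrailingDegree + q.natTrailingDegree = N := by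
    rw [← Polynomial.natTrailingDegree_mul hp hq, h,
      Polynomial.C_mul_X_pow_eq_monomial, Polynomial.natTrailingDegree_monomial hm]
  have h3 := p.natTrailingDegree_le_natDegree
  have h4 := q.natTrailingDegree_le_natDegree
  have key (r : Polynomial A) (hr : r.natTrailingDegree = r.natDegree) :
      r = Polynomial.C (r.coeff r.natDegree) * Polynomial.X ^ r.natDegree := by
    ext k
    rw [Polynomial.coeff_C_mul_X_pow]
    split_ifs with hk
    · rw [hk]
    · rcases lt_or_gt_of_ne hk with hk | hk
      · exact Polynomial.coeff_eq_zero_of_lt_natTrailingDegree (by lia)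
      · exact Polynomial.coeff_eq_zero_of_natDegree_lt hk
  exact ⟨_, _, h1, ⟨_, key p (by lia)⟩, ⟨_, key q (by lia)⟩⟩

variable {m : ℕ} {d : Fin m → ℕ}

lemma exists_scaling_of_mul (i : Fin m) {P Q : MvPolynomial (CoeffIdx m d) ℂ} {N : ℕ}
    (h0 : P * Q ≠ 0) (h : ∀ s c, eval (scaleCoeff i s c) (P * Q) = s ^ N * eval c (P * Q)) :
    ∃ a b, a + b = N ∧ (∀ s c, eval (scaleCoeff i s c) P = s ^ a * eval c P) ∧
      ∀ s c, eval (scaleCoeff i s c) Q = s ^ b * eval c Q := by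
  let φ : MvPolynomial (CoeffIdx m d) ℂ →ₐ[ℂ] Polynomial (MvPolynomial (CoeffIdx m d) ℂ) :=
    aeval (scaleCoeff i Polynomial.X fun v => Polynomial.C (X v))
  have hφ (p s c) : eval c (Polynomial.eval (C s) (φ p)) = eval (scaleCoeff i s c) p := by
    have : (eval c).comp ((Polynomial.evalRingHom (C s)).comp φ.toRingHom) =
        eval (scaleCoeff i s c) := by
      refine ringHom_ext (fun r => ?_) fun v => ?_
      · simp [φ, Polynomial.algebraMap_apply, algebraMap_eq]
      · simp only [φ, scaleCoeff, AlgHom.toRingHom_eq_coe, RingHom.comp_apply, RingHom.coe_coe,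
          aeval_X, eval_X]
        split_ifs
        · simpa using mul_comm _ _
        · simp
    exact RingHom.congr_fun this p
  have hφm : φ P * φ Q = Polynomial.C (P * Q) * Polynomial.X ^ N := by
    rw [← map_mul]
    refine Polynomial.eq_of_infinite_eval_eq _ _ ((Set.infinite_range_of_injective
      (C_injective (CoeffIdx m d) ℂ)).mono ?_)
    rintro _ ⟨s, rfl⟩
    refine MvPolynomial.funext fun c => ?_
    rw [hφ, h]
    simp [mul_comm]
  obtain ⟨a, b, hab, ⟨u, hu⟩, ⟨v, hv⟩⟩ := exists_eq_C_mul_X_pow_of_mul_eq h0 hφm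
  have key (p : MvPolynomial (CoeffIdx m d) ℂ) (a : ℕ) (u : MvPolynomial (CoeffIdx m d) ℂ)
      (hu : φ p = Polynomial.C u * Polynomial.X ^ a) (s c) :
      eval (scaleCoeff i s c) p = s ^ a * eval c p := by
    have h1 := hφ p 1 c
    have h2 := hφ p s c
    rw [hu] at h1 h2
    have h3 : scaleCoeff i 1 c = c := by
      ext v
      simp [scaleCoeff]
    rw [h3] at h1
    simp only [Polynomial.eval_mul, Polynomial.eval_C, Polynomial.eval_pow, Polynomial.eval_X,
      map_mul, map_pow, eval_C, one_pow, mul_one] at h1 h2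
    rw [← h2, h1, mul_comm]
  exact ⟨a, b, hab, key P a u hu, key Q b v hv⟩

/-- The restriction of a polynomial to the line `c₀ + t c₁`. -/
noncomputable def lineRestrict {ι : Type*} (c₀ c₁ : ι → ℂ) :
    MvPolynomial ι ℂ →ₐ[ℂ] Polynomial ℂ :=
  aeval fun v => Polynomial.C (c₀ v) + Polynomial.X * Polynomial.C (c₁ v)

lemma eval_lineRestrict {ι : Type*} (c₀ c₁ : ι → ℂ) (P : MvPolynomial ι ℂ) (t : ℂ) :
    (lineRestrict c₀ c₁ P).eval t = eval (c₀ + t • c₁) P := by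
  have : (Polynomial.aeval t).comp (lineRestrict c₀ c₁) = aeval (c₀ + t • c₁) := by
    refine algHom_ext fun v => ?_
    simpa [lineRestrict] using mul_comm _ _
  exact DFunLike.congr_fun this P

lemma natDegree_le_of_eval_inv {p q : Polynomial ℂ} (hp : p ≠ 0) {a : ℕ}
    (h : ∀ t, t ≠ 0 → p.eval t = t ^ a * q.eval t⁻¹) : p.natDegree ≤ a := by
  have h1 : Polynomial.X ^ q.natDegree * p = Polynomial.X ^ a * q.reverse := by
    refine Polynomial.eq_of_infinite_eval_eq _ _
      ((Set.finite_singleton (0 : ℂ)).infinite_compl.mono fun t ht => ?_)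
    have ht : t ≠ 0 := ht
    have := invertibleOfNonzero (inv_ne_zero ht)
    have h2 := Polynomial.eval₂_reverse_mul_pow (RingHom.id ℂ) t⁻¹ q
    rw [invOf_eq_inv, inv_inv, inv_pow] at h2
    simp only [Set.mem_ofPred_eq, Polynomial.eval_mul, Polynomial.eval_pow, Polynomial.eval_X]
    rw [h t ht]
    simp only [Polynomial.eval₂_id] at h2
    rw [← h2]
    field_simp
  have h2 := congrArg Polynomial.natDegree h1
  rw [Polynomial.natDegree_mul (pow_ne_zero _ Polynomial.X_ne_zero) hp,
    Polynomial.natDegree_X_pow] at h2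
  have h3 := (Polynomial.natDegree_mul_le (p := (Polynomial.X : Polynomial ℂ) ^ a)
    (q := q.reverse)).trans (Nat.add_le_add (Polynomial.natDegree_X_pow a).le
      q.reverse_natDegree_le)
  lia

lemma natDegree_lineRestrict_le (i : Fin m) {P : MvPolynomial (CoeffIdx m d) ℂ} {a : ℕ}
    (hP : ∀ s c, eval (scaleCoeff i s c) P = s ^ a * eval c P) (c₀ c₁ : CoeffIdx m d → ℂ)
    (hc : ∀ v : CoeffIdx m d, v.1 ≠ i → c₁ v = 0) (h0 : lineRestrict c₀ c₁ P ≠ 0) :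
    (lineRestrict c₀ c₁ P).natDegree ≤ a := by
  refine natDegree_le_of_eval_inv (q := lineRestrict (fun v => if v.1 = i then c₁ v else c₀ v)
    (fun v => if v.1 = i then c₀ v else 0) P) h0 fun t ht => ?_
  rw [eval_lineRestrict, eval_lineRestrict, ← hP]
  congr 2
  ext v
  by_cases hv : v.1 = i
  · simp [scaleCoeff, hv]
    field_simp
    ring
  · simp [scaleCoeff, hv, hc v hv]

end ScalingDegree

section ComplexResultant

/-- An irreducible complex polynomial in the coefficients whose vanishing characterizes the
existence of a nontrivial common zero. -/
structure IsComplexResultant {m : ℕ} (d : Fin m → ℕ) (P : MvPolynomial (CoeffIdx m d) ℂ) :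
    Prop where
  irreducible : Irreducible P
  eval_eq_zero_iff : ∀ c, eval c P = 0 ↔ ∃ x : Fin m → ℂ, x ≠ 0 ∧
    ∀ i, eval x (coeffForm c i) = 0

lemma exists_dvd_pow_of_zeros {ι : Type*} [Finite ι] {P M : MvPolynomial ι ℂ}
    (h : ∀ c, eval c P = 0 → eval c M = 0) : ∃ k, P ∣ M ^ k := by
  have : M ∈ (Ideal.span {P}).radical := by
    rw [← vanishingIdeal_zeroLocus_eq_radical (K := ℂ), mem_vanishingIdeal_iff]
    intro x hx
    exact h x (hx _ (Ideal.mem_span_singleton_self P))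
  obtain ⟨k, hk⟩ := this
  exact ⟨k, Ideal.mem_span_singleton.1 hk⟩

lemma IsComplexResultant.dvd {m : ℕ} {d : Fin m → ℕ} {P M : MvPolynomial (CoeffIdx m d) ℂ}
    (hP : IsComplexResultant d P)
    (hM : ∀ c, (∃ x, x ≠ 0 ∧ ∀ i, eval x (coeffForm c i) = 0) → eval c M = 0) : P ∣ M := by
  obtain ⟨k, hk⟩ := exists_dvd_pow_of_zeros fun c hc => hM c ((hP.eval_eq_zero_iff c).1 hc)
  exact hP.irreducible.prime.dvd_of_dvd_pow hk

variable {n : ℕ} {d : Fin (n + 1) → ℕ}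

/-- A line in the space of coefficients containing the expected number of systems with a
nontrivial common zero. -/
lemma exists_line_of_zeros (hd : ∀ i, 0 < d i) : ∃ c₀ c₁ : CoeffIdx (n + 1) d → ℂ,
    (∀ v : CoeffIdx (n + 1) d, v.1 ≠ Fin.last n → c₁ v = 0) ∧
    ∃ Z : Finset ℂ, Z.card = ∏ i : Fin n, d i.castSucc ∧
      ∀ t, (∃ x, x ≠ 0 ∧ ∀ i, eval x (coeffForm (c₀ + t • c₁) i) = 0) ↔ t ∈ Z := by
  classical
  let pt (k : (i : Fin n) → Fin (d i.castSucc)) (i : Fin n) : ℂ := ((k i : ℕ) : ℂ)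
  have hpt : Function.Injective pt := fun k k' h => by
    ext i
    exact Nat.cast_injective (R := ℂ) (congrFun h i)
  obtain ⟨w, hw⟩ := exists_linear_form_ne_zero
    ((Set.range fun k : _ × _ => pt k.1 - pt k.2) \ {0})
    ((Set.finite_range _).subset Set.sdiff_subset) fun x hx => hx.2
  let val (k : (i : Fin n) → Fin (d i.castSucc)) : ℂ := ∑ i, w i * pt k i
  have hval : Function.Injective val := fun k k' h => by
    by_contra hne
    refine hw (pt k - pt k') ⟨⟨(k, k'), rfl⟩, fun h0 => hne (hpt (sub_eq_zero.1 h0))⟩ ?_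
    simpa [mul_sub, sub_eq_zero] using h
  let F₀ : Fin (n + 1) → MvPolynomial (Fin (n + 1)) ℂ := Fin.snoc
    (fun i => ∏ k ∈ Finset.range (d (Fin.castSucc i)), (X i.castSucc - C (k : ℂ) * X (Fin.last n)))
    ((∑ i, C (w i) * X i.castSucc) * X (Fin.last n) ^ (d (Fin.last n) - 1))
  let F₁ : Fin (n + 1) → MvPolynomial (Fin (n + 1)) ℂ := Fin.snoc (fun _ => 0)
    (-X (Fin.last n) ^ d (Fin.last n))
  have hCX (i) (z : ℂ) : (C z * X i : MvPolynomial (Fin (n + 1)) ℂ).IsHomogeneous 1 := by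
    simpa using (isHomogeneous_C (Fin (n + 1)) z).mul (isHomogeneous_X ℂ i)
  have hF₀ (i) : (F₀ i).IsHomogeneous (d i) := by
    induction i using Fin.lastCases with
    | last =>
      have := (IsHomogeneous.sum Finset.univ _ 1 fun (i : Fin n) _ => hCX i.castSucc (w i)).mul
        (isHomogeneous_X_pow (R := ℂ) (Fin.last n) (d (Fin.last n) - 1))
      rw [Nat.add_sub_cancel' (hd _)] at this
      simpa [F₀] using this
    | cast i =>
      have := IsHomogeneous.prod (Finset.range (d (Fin.castSucc i))) (fun k : ℕ =>
        (X i.castSucc - C (k : ℂ) * X (Fin.last n) : MvPolynomial (Fin (n + 1)) ℂ)) (fun _ => 1)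
        fun k _ => (isHomogeneous_X ℂ _).sub (hCX _ _)
      simpa [F₀] using this
  have hF₁ (i) : (F₁ i).IsHomogeneous (d i) := by
    induction i using Fin.lastCases with
    | last => simpa [F₁] using (isHomogeneous_X_pow (R := ℂ) (Fin.last n) _).neg
    | cast i => simpa [F₁] using isHomogeneous_zero _ _ _
  have hc (t : ℂ) : coeffForm (formCoeff d F₀ + t • formCoeff d F₁) = F₀ + t • F₁ := by
    have h1 : formCoeff d F₀ + t • formCoeff d F₁ = formCoeff d (F₀ + t • F₁) := by
      ext v
      simp [formCoeff]
    rw [h1]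
    exact coeffForm_formCoeff fun i => (hF₀ i).add (Submodule.smul_mem
      (homogeneousSubmodule (Fin (n + 1)) ℂ (d i)) t (hF₁ i))
  refine ⟨formCoeff d F₀, formCoeff d F₁, fun ⟨i, γ⟩ hv => ?_, Finset.univ.image val, ?_,
    fun t => ?_⟩
  · induction i using Fin.lastCases with
    | last => exact absurd rfl hv
    | cast i => simp [formCoeff, F₁]
  · rw [Finset.card_image_of_injective _ hval]
    simp
  have hlast (x : Fin (n + 1) → ℂ) : eval x ((F₀ + t • F₁) (Fin.last n)) =
      ((∑ i, w i * x i.castSucc) - t * x (Fin.last n)) *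
        x (Fin.last n) ^ (d (Fin.last n) - 1) := by
    have : x (Fin.last n) ^ d (Fin.last n) =
        x (Fin.last n) * x (Fin.last n) ^ (d (Fin.last n) - 1) := by
      rw [← pow_succ', Nat.sub_add_cancel (hd _)]
    simp [F₀, F₁, this]
    ring
  have hcast (x : Fin (n + 1) → ℂ) (i : Fin n) : eval x ((F₀ + t • F₁) i.castSucc) =
      ∏ k ∈ Finset.range (d i.castSucc), (x i.castSucc - k * x (Fin.last n)) := by
    simp [F₀, F₁]
  rw [hc, Finset.mem_image]
  constructor
  · rintro ⟨x, hx, hz⟩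
    have hk (i : Fin n) : ∃ k : Fin (d i.castSucc),
        x i.castSucc = ((k : ℕ) : ℂ) * x (Fin.last n) := by
      have := hz i.castSucc
      rw [hcast, Finset.prod_eq_zero_iff] at this
      obtain ⟨k, hk, h0⟩ := this
      exact ⟨⟨k, Finset.mem_range.1 hk⟩, sub_eq_zero.1 h0⟩
    choose k hk using hk
    have hne : x (Fin.last n) ≠ 0 := fun h0 => hx (by
      ext i
      induction i using Fin.lastCases with
      | last => exact h0
      | cast i => rw [hk, h0, mul_zero, Pi.zero_apply])
    refine ⟨k, Finset.mem_univ _, ?_⟩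
    have := hz (Fin.last n)
    rw [hlast, mul_eq_zero, or_iff_left (pow_ne_zero _ hne), sub_eq_zero] at this
    refine mul_right_cancel₀ hne (Eq.trans ?_ this)
    simp [val, pt, Finset.sum_mul, hk, mul_assoc]
  · rintro ⟨k, -, rfl⟩
    refine ⟨Fin.snoc (pt k) 1, fun h => ?_, fun i => ?_⟩
    · simpa using congrFun h (Fin.last n)
    · induction i using Fin.lastCases with
      | last =>
        rw [hlast]
        simp [val]
      | cast i =>
        rw [hcast, Finset.prod_eq_zero_iff]
        exact ⟨k i, Finset.mem_range.2 (k i).2, by simp [pt]⟩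

lemma IsComplexResultant.prod_le {P : MvPolynomial (CoeffIdx (n + 1) d) ℂ}
    (hP : IsComplexResultant d P) (hd : ∀ i, 0 < d i) {a : ℕ}
    (ha : ∀ s c, eval (scaleCoeff (Fin.last n) s c) P = s ^ a * eval c P) :
    ∏ i : Fin n, d i.castSucc ≤ a := by
  obtain ⟨c₀, c₁, hc₁, Z, hZ, h⟩ := exists_line_of_zeros hd
  have hroot (t) : (lineRestrict c₀ c₁ P).eval t = 0 ↔ t ∈ Z := by
    rw [eval_lineRestrict, hP.eval_eq_zero_iff, h]
  have h0 : lineRestrict c₀ c₁ P ≠ 0 := fun h0 => by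
    obtain ⟨t, ht⟩ := Infinite.exists_notMem_finset Z
    exact ht ((hroot t).1 (by rw [h0, Polynomial.eval_zero]))
  refine le_trans ?_ (natDegree_lineRestrict_le _ ha c₀ c₁ hc₁ h0)
  rw [← hZ]
  refine Polynomial.card_le_degree_of_subset_roots fun t ht => ?_
  exact (Polynomial.mem_roots h0).2 ((hroot t).2 ht)

lemma IsComplexResultant.exists_cofactor {P : MvPolynomial (CoeffIdx (n + 1) d) ℂ}
    (hP : IsComplexResultant d P) (hd : ∀ i, 0 < d i)
    (G : Fin n → MvPolynomial (Fin (n + 1)) ℂ) (hG : ∀ i, (G i).IsHomogeneous (d i.castSucc))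
    (h : ∀ x, (∀ i, eval x (G i) = 0) → x (Fin.last n) = 0 → x = 0) :
    (∀ s c, eval (scaleCoeff (Fin.last n) s c) P =
      s ^ (∏ i : Fin n, d i.castSucc) * eval c P) ∧
    ∃ Q : MvPolynomial (CoeffIdx (n + 1) d) ℂ,
      (∀ s c, eval (scaleCoeff (Fin.last n) s c) Q = eval c Q) ∧
      ∀ F : Fin (n + 1) → MvPolynomial (Fin (n + 1)) ℂ, (∀ i, (F i).IsHomogeneous (d i)) →
        (∀ i : Fin n, F i.castSucc = G i) →
        eval (formCoeff d F) P * eval (formCoeff d F) Q =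
          LinearMap.det (LinearMap.mulLeft ℂ (Ideal.Quotient.mk
            (Ideal.span (Set.range fun i => dehomogenize n (G i)))
            (dehomogenize n (F (Fin.last n))))) := by
  obtain ⟨-, M, hM, hMs, hMdet⟩ := exists_macaulay d hd G hG h
  obtain ⟨Q, rfl⟩ := hP.dvd hM
  have h0 : P * Q ≠ 0 := fun h0 => by
    have := hMdet (Fin.snoc G (X (Fin.last n) ^ d (Fin.last n))) (fun i => by
      induction i using Fin.lastCases with
      | last => simpa using isHomogeneous_X_pow (R := ℂ) (Fin.last n) _
      | cast i => simpa using hG i) (fun i => by simp)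
    rw [h0, map_zero, Fin.snoc_last, map_pow, dehomogenize_X_last, one_pow, map_one,
      LinearMap.mulLeft_one, LinearMap.det_id] at this
    exact zero_ne_one this
  obtain ⟨a, b, hab, ha, hb⟩ := exists_scaling_of_mul (Fin.last n) h0 hMs
  have hle := hP.prod_le hd ha
  obtain rfl : b = 0 := by lia
  obtain rfl : a = _ := hab
  refine ⟨ha, Q, fun s c => by rw [hb, pow_zero, one_mul], fun F hF hFG => ?_⟩
  rw [← map_mul, hMdet F hF hFG]

lemma IsComplexResultant.eval_scaleCoeff_last {P : MvPolynomial (CoeffIdx (n + 1) d) ℂ}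
    (hP : IsComplexResultant d P) (hd : ∀ i, 0 < d i) (s : ℂ) (c : CoeffIdx (n + 1) d → ℂ) :
    eval (scaleCoeff (Fin.last n) s c) P = s ^ (∏ i : Fin n, d i.castSucc) * eval c P := by
  refine (hP.exists_cofactor hd (fun i => X i.castSucc ^ d i.castSucc)
    (fun i => isHomogeneous_X_pow _ _) fun x hx hl => ?_).1 s c
  ext i
  induction i using Fin.lastCases with
  | last => exact hl
  | cast i => exact eq_zero_of_pow_eq_zero (by simpa using hx i)

/-- The dependence of the resultant on the last form. -/
lemma IsComplexResultant.eval_eq_mul_det {P : MvPolynomial (CoeffIdx (n + 1) d) ℂ}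
    (hP : IsComplexResultant d P) (hd : ∀ i, 0 < d i)
    (F : Fin (n + 1) → MvPolynomial (Fin (n + 1)) ℂ) (hF : ∀ i, (F i).IsHomogeneous (d i))
    (h : ∀ x, (∀ i : Fin n, eval x (F i.castSucc) = 0) → x (Fin.last n) = 0 → x = 0) :
    eval (formCoeff d F) P =
      eval (formCoeff d (Fin.snoc (fun i => F (Fin.castSucc i))
        (X (Fin.last n) ^ d (Fin.last n)))) P *
      LinearMap.det (LinearMap.mulLeft ℂ (Ideal.Quotient.mk
        (Ideal.span (Set.range fun i : Fin n => dehomogenize n (F i.castSucc)))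
        (dehomogenize n (F (Fin.last n))))) := by
  obtain ⟨-, Q, hQs, hQ⟩ := hP.exists_cofactor hd (fun i => F (Fin.castSucc i))
    (fun i => hF _) h
  have h1 := hQ F hF fun i => rfl
  have h2 := hQ (Fin.snoc (fun i => F (Fin.castSucc i)) (X (Fin.last n) ^ d (Fin.last n)))
    (fun i => by
      induction i using Fin.lastCases with
      | last => simpa using isHomogeneous_X_pow (R := ℂ) (Fin.last n) _
      | cast i => simpa using hF _) (fun i => by simp)
  rw [Fin.snoc_last, map_pow, dehomogenize_X_last, one_pow, map_one,
      LinearMap.mulLeft_one, LinearMap.det_id] at h2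
  have h3 : eval (formCoeff d F) Q = eval (formCoeff d (Fin.snoc (fun i => F (Fin.castSucc i))
      (X (Fin.last n) ^ d (Fin.last n)))) Q := by
    rw [← hQs 0, ← hQs 0 (formCoeff d (Fin.snoc _ _))]
    congr 2
    ext ⟨i, γ⟩
    induction i using Fin.lastCases with
    | last => simp [scaleCoeff]
    | cast i => simp [scaleCoeff, formCoeff, Fin.castSucc_ne_last]
  rw [← h1, h3, mul_left_comm, h2, mul_one]

end ComplexResultant

section Specialization

lemma IsComplexResultant.rename_perm {m : ℕ} {d : Fin m → ℕ}
    {P : MvPolynomial (CoeffIdx m d) ℂ} (hP : IsComplexResultant d P) (σ : Equiv.Perm (Fin m))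
    (e : CoeffIdx m (d ∘ σ) ≃ CoeffIdx m d) (he : ∀ v, e v = ⟨σ v.1, v.2⟩) :
    IsComplexResultant (d ∘ σ) (rename e.symm P) where
  irreducible := (MulEquiv.irreducible_iff (renameEquiv ℂ e.symm)).2 hP.irreducible
  eval_eq_zero_iff c := by
    rw [eval_rename, hP.eval_eq_zero_iff]
    have h (i) : coeffForm (c ∘ e.symm) (σ i) = coeffForm c i := by
      refine Finset.sum_congr rfl fun γ _ => ?_
      have : e.symm ⟨σ i, γ⟩ = ⟨i, γ⟩ := by rw [Equiv.symm_apply_eq, he]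
      rw [Function.comp_apply, this]
    refine exists_congr fun x => and_congr_right fun _ => ?_
    rw [← σ.forall_congr_right]
    simp_rw [h]

variable {n : ℕ} {d : Fin (n + 1) → ℕ}

lemma IsComplexResultant.eval_scaleCoeff {P : MvPolynomial (CoeffIdx (n + 1) d) ℂ}
    (hP : IsComplexResultant d P) (hd : ∀ i, 0 < d i) (j : Fin (n + 1)) (s : ℂ)
    (c : CoeffIdx (n + 1) d → ℂ) :
    eval (scaleCoeff j s c) P =
      s ^ (∏ i : Fin n, d (Equiv.swap j (Fin.last n) i.castSucc)) * eval c P := by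
  let σ := Equiv.swap j (Fin.last n)
  let e : CoeffIdx (n + 1) (d ∘ σ) ≃ CoeffIdx (n + 1) d :=
    Equiv.sigmaCongrLeft (β := fun i => Mono (n + 1) (d i)) σ
  have he (v) : e v = ⟨σ v.1, v.2⟩ := rfl
  have h1 := (hP.rename_perm σ e he).eval_scaleCoeff_last (fun i => hd _) s (c ∘ e)
  have h2 : scaleCoeff (Fin.last n) s (c ∘ e) = scaleCoeff j s c ∘ e := by
    ext v
    have : v.1 = Fin.last n ↔ (e v).1 = j := by
      rw [he, ← σ.apply_eq_iff_eq, Equiv.swap_apply_right]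
    simp [scaleCoeff, this]
  rw [h2, eval_rename, eval_rename, Function.comp_assoc, Function.comp_assoc, e.self_comp_symm,
    Function.comp_id, Function.comp_id] at h1
  exact h1

/-- The forms `G₀, …, G_{n-1}` in one more variable, together with a power of the last variable. -/
noncomputable def extendForms (e : ℕ) (G : Fin n → MvPolynomial (Fin n) ℂ) :
    Fin (n + 1) → MvPolynomial (Fin (n + 1)) ℂ :=
  Fin.snoc (fun i => rename Fin.castSucc (G i)) (X (Fin.last n) ^ e)

lemma isHomogeneous_extendForms {G : Fin n → MvPolynomial (Fin n) ℂ}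
    (hG : ∀ i, (G i).IsHomogeneous (d i.castSucc)) (i : Fin (n + 1)) :
    (extendForms (d (Fin.last n)) G i).IsHomogeneous (d i) := by
  induction i using Fin.lastCases with
  | last => simpa [extendForms] using isHomogeneous_X_pow (R := ℂ) (Fin.last n) _
  | cast i => simpa [extendForms] using (hG i).rename_isHomogeneous

lemma exists_zero_extendForms_iff {e : ℕ} (he : 0 < e) (G : Fin n → MvPolynomial (Fin n) ℂ) :
    (∃ x, x ≠ 0 ∧ ∀ i, eval x (extendForms e G i) = 0) ↔
      ∃ x, x ≠ 0 ∧ ∀ i, eval x (G i) = 0 := by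
  constructor
  · rintro ⟨x, hx, h⟩
    refine ⟨x ∘ Fin.castSucc, fun h0 => hx ?_, fun i => ?_⟩
    · ext i
      induction i using Fin.lastCases with
      | last => exact eq_zero_of_pow_eq_zero (by simpa [extendForms] using h (Fin.last n))
      | cast i => exact congrFun h0 i
    · simpa [extendForms, eval_rename] using h i.castSucc
  · rintro ⟨x, hx, h⟩
    have hs : (Fin.snoc x 0 : Fin (n + 1) → ℂ) ∘ Fin.castSucc = x := by
      ext i
      simp
    refine ⟨Fin.snoc x 0, fun h0 => hx ?_, fun i => ?_⟩
    · rw [← hs, h0]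
      rfl
    · induction i using Fin.lastCases with
      | last => simp [extendForms, he.ne']
      | cast i => simp [extendForms, eval_rename, hs, h]

lemma exists_eval_eq_extendForms (P : MvPolynomial (CoeffIdx (n + 1) d) ℂ) :
    ∃ P₀ : MvPolynomial (CoeffIdx n fun i => d i.castSucc) ℂ, ∀ c, eval c P₀ =
      eval (formCoeff d (extendForms (d (Fin.last n)) (coeffForm c))) P := by
  have h (v : CoeffIdx (n + 1) d) : ∃ q : MvPolynomial (CoeffIdx n fun i => d i.castSucc) ℂ,
      ∀ c, eval c q = formCoeff d (extendForms (d (Fin.last n)) (coeffForm c)) v := by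
    obtain ⟨i, α⟩ := v
    induction i using Fin.lastCases with
    | last =>
      exact ⟨C (coeff α.toFinsupp (X (Fin.last n) ^ d (Fin.last n))), fun c => by
        simp [formCoeff, extendForms]⟩
    | cast i =>
      refine ⟨∑ γ, C (coeff α.toFinsupp (rename Fin.castSucc
        (monomial (Mono.toFinsupp γ) (1 : ℂ)))) * X ⟨i, γ⟩, fun c => ?_⟩
      simp only [formCoeff, extendForms, coeffForm, Fin.snoc_castSucc, map_sum, coeff_sum,
        map_mul, eval_C, eval_X]
      refine Finset.sum_congr rfl fun γ _ => ?_
      rw [rename_monomial, rename_monomial, mul_comm, ← smul_eq_mul, ← coeff_smul, smul_monomial,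
        smul_eq_mul, mul_one]
  choose q hq using h
  refine ⟨aeval q P, fun c => ?_⟩
  have : (eval c).comp (aeval q : _ →ₐ[ℂ] MvPolynomial (CoeffIdx n fun i => d i.castSucc) ℂ) =
      eval (formCoeff d (extendForms (d (Fin.last n)) (coeffForm c))) := by
    refine ringHom_ext (fun r => ?_) fun v => ?_
    · simp [algebraMap_eq]
    · simp [hq]
  exact RingHom.congr_fun this P

/-- Setting the last variable equal to `0` when the last form is a power of it. -/
lemma IsComplexResultant.eval_snoc_eq {P : MvPolynomial (CoeffIdx (n + 1) d) ℂ}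
    (hP : IsComplexResultant d P)
    (F : Fin n → MvPolynomial (Fin (n + 1)) ℂ) (hF : ∀ i, (F i).IsHomogeneous (d i.castSucc))
    (h : ∀ x, (∀ i : Fin n, eval x (F i) = 0) → x (Fin.last n) = 0 → x = 0)
    (G : Fin n → MvPolynomial (Fin n) ℂ)
    (hFG : ∀ i x, eval x (G i) = eval (Fin.snoc x 0 : Fin (n + 1) → ℂ) (F i)) :
    eval (formCoeff d (Fin.snoc F (X (Fin.last n) ^ d (Fin.last n)))) P =
      eval (formCoeff d (extendForms (d (Fin.last n)) G)) P := by
  set F' : Fin (n + 1) → MvPolynomial (Fin (n + 1)) ℂ :=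
    Fin.snoc F (X (Fin.last n) ^ d (Fin.last n)) with hF'
  have hF'h (i) : (F' i).IsHomogeneous (d i) := by
    induction i using Fin.lastCases with
    | last => simpa [F'] using isHomogeneous_X_pow (R := ℂ) (Fin.last n) _
    | cast i => simpa [F'] using hF i
  let e (v : CoeffIdx (n + 1) d) : ℕ := if v.1 = Fin.last n then 0 else v.2.1 (Fin.last n)
  let p : Polynomial ℂ := aeval (fun v => Polynomial.C (formCoeff d F' v) * Polynomial.X ^ e v) P
  have hp (t : ℂ) : p.eval t = eval (fun v => formCoeff d F' v * t ^ e v) P := by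
    have : (Polynomial.aeval t).comp
        (aeval fun v => Polynomial.C (formCoeff d F' v) * Polynomial.X ^ e v) =
        aeval (fun v => formCoeff d F' v * t ^ e v) := by
      refine algHom_ext fun v => ?_
      simp
    exact DFunLike.congr_fun this P
  have hlast (t : ℂ) : coeffForm (fun v => formCoeff d F' v * t ^ e v) (Fin.last n) =
      X (Fin.last n) ^ d (Fin.last n) := by
    have : coeffForm (fun v => formCoeff d F' v * t ^ e v) (Fin.last n) =
        coeffForm (formCoeff d F') (Fin.last n) := by
      simp [coeffForm, e]
    rw [this, coeffForm_formCoeff hF'h, hF', Fin.snoc_last]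
  have hcast (t : ℂ) (i : Fin n) (x : Fin (n + 1) → ℂ) :
      eval x (coeffForm (fun v => formCoeff d F' v * t ^ e v) i.castSucc) =
      eval (Fin.snoc (x ∘ Fin.castSucc) (t * x (Fin.last n)) : Fin (n + 1) → ℂ) (F i) := by
    have h1 : F i = coeffForm (formCoeff d F') i.castSucc := by
      rw [coeffForm_formCoeff hF'h, hF', Fin.snoc_castSucc]
    rw [h1, coeffForm, coeffForm, map_sum, map_sum]
    refine Finset.sum_congr rfl fun γ _ => ?_
    rw [eval_monomial, eval_monomial, Finsupp.prod_fintype _ _ fun _ => pow_zero _,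
      Finsupp.prod_fintype _ _ fun _ => pow_zero _, Fin.prod_univ_castSucc, Fin.prod_univ_castSucc]
    simp [e, Fin.castSucc_ne_last, mul_pow]
    ring
  have hne (t : ℂ) : p.eval t ≠ 0 := by
    rw [hp, Ne, hP.eval_eq_zero_iff]
    rintro ⟨x, hx, hz⟩
    have h0 : x (Fin.last n) = 0 := by
      have := hz (Fin.last n)
      rw [hlast] at this
      exact eq_zero_of_pow_eq_zero (by simpa using this)
    have hx' : (Fin.snoc (x ∘ Fin.castSucc) 0 : Fin (n + 1) → ℂ) = x := by
      ext j
      induction j using Fin.lastCases <;> simp [h0]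
    refine hx (h x (fun i => ?_) h0)
    have := hz i.castSucc
    rw [hcast, h0, mul_zero] at this
    rwa [hx'] at this
  have hdeg : p.degree = 0 := by
    by_contra hdeg
    obtain ⟨t, ht⟩ := IsAlgClosed.exists_root p hdeg
    exact hne t ht
  have h01 : p.eval 1 = p.eval 0 := by
    rw [Polynomial.eq_C_of_degree_eq_zero hdeg, Polynomial.eval_C, Polynomial.eval_C]
  rw [hp, hp] at h01
  simp only [one_pow, mul_one] at h01
  rw [show formCoeff d F' = fun v => formCoeff d F' v from rfl, h01]
  congr 2
  rw [← formCoeff_coeffForm (fun v => formCoeff d F' v * 0 ^ e v)]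
  congr 1
  ext1 i
  induction i using Fin.lastCases with
  | last => rw [hlast, extendForms, Fin.snoc_last]
  | cast i =>
    refine MvPolynomial.funext fun x => ?_
    rw [hcast, extendForms, Fin.snoc_castSucc, eval_rename, hFG, zero_mul]

lemma formCoeff_extendForms_scaleCoeff (j : Fin n) (s : ℂ)
    (c : CoeffIdx n (fun i => d i.castSucc) → ℂ) :
    formCoeff d (extendForms (d (Fin.last n)) (coeffForm (scaleCoeff j s c))) =
      scaleCoeff j.castSucc s
        (formCoeff d (extendForms (d (Fin.last n)) (coeffForm c))) := by
  ext ⟨i, γ⟩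
  induction i using Fin.lastCases with
  | last => simp [formCoeff, extendForms, scaleCoeff, (Fin.castSucc_ne_last j).symm]
  | cast i =>
    simp only [formCoeff, extendForms, scaleCoeff, Fin.snoc_castSucc, coeffForm_scaleCoeff,
      Fin.castSucc_inj]
    split_ifs <;> simp

lemma prod_swap_castSucc_last {M : Type*} [CommMonoid M] (f : Fin (n + 2) → M) :
    ∏ i : Fin (n + 1), f (Equiv.swap (Fin.last n).castSucc (Fin.last (n + 1)) i.castSucc) =
      f (Fin.last (n + 1)) * ∏ i : Fin n, f i.castSucc.castSucc := by
  rw [Fin.prod_univ_castSucc, Equiv.swap_apply_left, mul_comm]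
  congr 1
  refine Finset.prod_congr rfl fun i _ => ?_
  rw [Equiv.swap_apply_of_ne_of_ne]
  · exact fun h => Fin.castSucc_ne_last i (Fin.castSucc_injective _ h)
  · exact Fin.castSucc_ne_last _

lemma extendForms_X_pow : extendForms (d (Fin.last n)) (fun i => X i ^ d i.castSucc) =
    fun i => X i ^ d i := by
  ext1 i
  induction i using Fin.lastCases <;> simp [extendForms]

/-- The resultant of the forms `G₀, …, G_{n-1}` in `n` variables and of a power of the last
variable is a power of the resultant of `G₀, …, G_{n-1}`. -/
lemma IsComplexResultant.eval_extendForms {d : Fin (n + 2) → ℕ}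
    {P : MvPolynomial (CoeffIdx (n + 2) d) ℂ}
    (hP : IsComplexResultant d P) (hP1 : eval (formCoeff d fun i => X i ^ d i) P = 1)
    {P' : MvPolynomial (CoeffIdx (n + 1) fun i => d i.castSucc) ℂ}
    (hP' : IsComplexResultant (fun i => d i.castSucc) P')
    (hP'1 : eval (formCoeff (fun i => d i.castSucc) fun i => X i ^ d i.castSucc) P' = 1)
    (hd : ∀ i, 0 < d i) (c : CoeffIdx (n + 1) (fun i => d i.castSucc) → ℂ) :
    eval (formCoeff d (extendForms (d (Fin.last (n + 1))) (coeffForm c))) P =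
      eval c P' ^ d (Fin.last (n + 1)) := by
  obtain ⟨P₀, hP₀⟩ := exists_eval_eq_extendForms P
  have hzero (c) (hc : eval c P₀ = 0) : eval c P' = 0 := by
    rw [hP₀, hP.eval_eq_zero_iff,
      coeffForm_formCoeff (isHomogeneous_extendForms (isHomogeneous_coeffForm c)),
      exists_zero_extendForms_iff (hd _)] at hc
    exact (hP'.eval_eq_zero_iff c).2 hc
  obtain ⟨k, hk⟩ := exists_dvd_pow_of_zeros hzero
  obtain ⟨b, -, hb⟩ := (dvd_prime_pow hP'.irreducible.prime k).1 hk
  obtain ⟨u, hu⟩ := hb.symm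
  obtain ⟨r, -, hr⟩ := MvPolynomial.isUnit_iff_eq_C_of_isReduced.1 u.isUnit
  have hX (i : Fin (n + 1)) :
      (X i ^ d i.castSucc : MvPolynomial (Fin (n + 1)) ℂ).IsHomogeneous (d i.castSucc) :=
    isHomogeneous_X_pow _ _
  have hX1 : eval (formCoeff (fun i => d i.castSucc) fun i => X i ^ d i.castSucc) P₀ = 1 := by
    rw [hP₀, coeffForm_formCoeff hX, extendForms_X_pow, hP1]
  have hr1 : r = 1 := by
    have := hX1
    rw [← hu, hr, map_mul, map_pow, hP'1, one_pow, one_mul, eval_C] at this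
    exact this
  have hPb (c) : eval c P₀ = eval c P' ^ b := by
    rw [← hu, hr, hr1, C_1, mul_one, map_pow]
  suffices hbd : b = d (Fin.last (n + 1)) by rw [← hP₀, hPb, hbd]
  set c₁ := formCoeff (fun i : Fin (n + 1) => d i.castSucc) fun i => X i ^ d i.castSucc
  have h1 := hPb (scaleCoeff (Fin.last n) 2 c₁)
  rw [hP₀, formCoeff_extendForms_scaleCoeff, hP.eval_scaleCoeff hd, ← hP₀, hX1,
    hP'.eval_scaleCoeff_last (fun i => hd _), hP'1, mul_one, mul_one, prod_swap_castSucc_last,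
    ← pow_mul, mul_comm _ b] at h1
  have h2 : (2 : ℕ) ^ (d (Fin.last (n + 1)) * ∏ i : Fin n, d i.castSucc.castSucc) =
      2 ^ (b * ∏ i : Fin n, d i.castSucc.castSucc) := by exact_mod_cast h1
  exact (Nat.eq_of_mul_eq_mul_right (Finset.prod_pos fun i _ => hd _)
    (Nat.pow_right_injective le_rfl h2)).symm

end Specialization

section Integral

lemma IsResultant.isComplexResultant {m : ℕ} {d : Fin m → ℕ} {R : MvPolynomial (CoeffIdx m d) ℤ}
    (hR : IsResultant m d R) : IsComplexResultant d (map (Int.castRingHom ℂ) R) where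
  irreducible := hR.2.2.1
  eval_eq_zero_iff c := by
    rw [hR.1 _ (isHomogeneous_coeffForm c), resEval_eq_eval, formCoeff_coeffForm]

lemma not_irreducible_of_isEmpty {ι k : Type*} [IsEmpty ι] [Field k] (p : MvPolynomial ι k) :
    ¬ Irreducible p := by
  rw [eq_C_of_isEmpty p]
  intro h
  refine h.not_isUnit ((Ne.isUnit fun h0 => h.ne_zero ?_).map C)
  rw [h0, C_0]

end Integral

/-- The Poisson formula. Let `F_0, …, F_n` be homogeneous of degrees `d_0, …, d_n`, let
`f_i := F_i(x_0,…,x_{n-1},1)` and `F̄_i := F_i(x_0,…,x_{n-1},0)`. If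
`Res(F̄_0,…,F̄_{n-1}) ≠ 0`, then `A = ℂ[x_0,…,x_{n-1}]/(f_0,…,f_{n-1})` has dimension
`d_0 ⋯ d_{n-1}` as a `ℂ`-vector space, and
`Res(F_0,…,F_n) = Res(F̄_0,…,F̄_{n-1})^{d_n} ⬝ det(m_{f_n} : A → A)`. -/
theorem resultant_poisson_formula (n : ℕ) (d : Fin (n + 1) → ℕ) (hd : ∀ i, 0 < d i)
    (R : MvPolynomial (CoeffIdx (n + 1) d) ℤ) (hR : IsResultant (n + 1) d R)
    (R' : MvPolynomial (CoeffIdx n fun i => d i.castSucc) ℤ)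
    (hR' : IsResultant n (fun i => d i.castSucc) R')
    (F : Fin (n + 1) → MvPolynomial (Fin (n + 1)) ℂ)
    (hF : ∀ i, (F i).IsHomogeneous (d i))
    -- the dehomogenizations `f_i = F_i(x_0,…,x_{n-1},1)` and `F̄_i = F_i(x_0,…,x_{n-1},0)` :
    (f Fbar : Fin (n + 1) → MvPolynomial (Fin n) ℂ)
    (hf : ∀ i, f i = aeval (Fin.snoc (fun j => X j) (1 : MvPolynomial (Fin n) ℂ)) (F i))
    (hFbar : ∀ i, Fbar i = aeval (Fin.snoc (fun j => X j) (0 : MvPolynomial (Fin n) ℂ)) (F i))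
    (hres : resEval (fun i => d i.castSucc) (fun i => Fbar i.castSucc) R' ≠ 0) :
    Module.finrank ℂ
        (MvPolynomial (Fin n) ℂ ⧸ Ideal.span (Set.range fun i : Fin n => f i.castSucc)) =
      ∏ i : Fin n, d i.castSucc ∧
    resEval d F R =
      (resEval (fun i => d i.castSucc) (fun i => Fbar i.castSucc) R') ^ d (Fin.last n) *
        LinearMap.det
          (LinearMap.mulLeft ℂ
            (Ideal.Quotient.mk (Ideal.span (Set.range fun i : Fin n => f i.castSucc))
              (f (Fin.last n)))) := by
  obtain rfl : f = fun i => dehomogenize n (F i) := _root_.funext hf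
  cases n with
  | zero => exact absurd hR'.2.2.1 (not_irreducible_of_isEmpty _)
  | succ n =>
    have hFbar0 (i) : Fbar i = hyperplaneRestrict 0 (F i) := by
      rw [hFbar, hyperplaneRestrict]
      simp
    have hG (i : Fin (n + 1)) : (Fbar i.castSucc).IsHomogeneous (d i.castSucc) := by
      rw [hFbar0]
      exact isHomogeneous_hyperplaneRestrict _ (hF _)
    have hFG (i : Fin (n + 1)) (x) : eval x (Fbar i.castSucc) =
        eval (Fin.snoc x 0 : Fin (n + 2) → ℂ) (F i.castSucc) := by
      rw [hFbar0, eval_hyperplaneRestrict]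
      simp
    have h (x : Fin (n + 2) → ℂ) (hx : ∀ i : Fin (n + 1), eval x (F i.castSucc) = 0)
        (h0 : x (Fin.last (n + 1)) = 0) : x = 0 := by
      have hx' : (Fin.snoc (x ∘ Fin.castSucc) 0 : Fin (n + 2) → ℂ) = x := by
        ext j
        induction j using Fin.lastCases <;> simp [h0]
      by_contra hne
      refine hres ((hR'.1 _ hG).1 ⟨x ∘ Fin.castSucc, fun hxc => hne ?_, fun i => ?_⟩)
      · rw [← hx', hxc]
        ext j
        induction j using Fin.lastCases <;> simp
      · rw [hFG, hx', hx]
    refine ⟨(exists_macaulay d hd _ (fun i => hF _) h).1, ?_⟩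
    have hR1 := hR.2.2.2
    have hR'1 := hR'.2.2.2
    rw [resEval_eq_eval] at hR1 hR'1 ⊢
    rw [hR.isComplexResultant.eval_eq_mul_det hd F hF h,
      hR.isComplexResultant.eval_snoc_eq _ (fun i => hF _) h _ hFG, resEval_eq_eval,
      ← hR.isComplexResultant.eval_extendForms hR1 hR'.isComplexResultant hR'1 hd,
      coeffForm_formCoeff hG]
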